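/- Suppose V : ℝ → ℝ is a continuous T-periodic potential, ε > 0, and Λ, R > 1. Then there exists N₀ ∈ ℤ₊ such that for all integers N ≥ N₀, there exists a continuous T̃ := NT-periodic potential Ṽ with ‖V - Ṽ‖_∞ < ε and Leb(σ(H_{λṼ}) ∩ [-R,R]) ≤ e^{-T̃^{1/2}} for all λ ∈ [Λ^{-1}, Λ]. -/

import Mathlib

open MeasureTheory Filter Set BoundedContinuousFunction
open scoped ENNReal

noncomputable section
/-- The spectrum of the Schrödinger operator `H_V φ = -φ'' + Vφ` on `L²(ℝ)`, characterized
via Weyl sequences drawn from the core `C_c²(ℝ)` of the (essentially self-adjoint) operator: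
`E ∈ σ(H_V)` iff there are compactly supported `C²` functions `u` of unit `L²` norm with
`‖(H_V - E)u‖_{L²}` arbitrarily small. -/
def schrodingerSpectrum (V : ℝ → ℝ) : Set ℝ :=
  {E : ℝ | ∀ ε : ℝ, 0 < ε → ∃ u : ℝ → ℂ,
    ContDiff ℝ 2 u ∧ HasCompactSupport u ∧
    (∫ x : ℝ, ‖u x‖ ^ 2) = 1 ∧
    (∫ x : ℝ, ‖-deriv (deriv u) x + (V x : ℂ) * u x - (E : ℂ) * u x‖ ^ 2) < ε}


/-! ### Part A: algebra of SL2 words -/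

lemma sl_commutator_trace (X Y : Matrix (Fin 2) (Fin 2) ℝ) :
    (X * Y * X.adjugate * Y.adjugate).trace = 2 * X.det * Y.det - (X * Y - Y * X).det := by
  simp [Matrix.trace_fin_two, Matrix.det_fin_two, Matrix.adjugate_fin_two, Matrix.mul_apply,
    Fin.sum_univ_two]
  ring

lemma sl_elliptic_comm (X Y : Matrix (Fin 2) (Fin 2) ℝ) (hX : X.det = 1)
    (ht : |X.trace| < 2) (hne : X * Y ≠ Y * X) : (X * Y - Y * X).det < 0 := by
  set K := X * Y - Y * X with hK
  have hK0 : K ≠ 0 := sub_ne_zero.mpr hne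
  have h1 : K 0 0 + K 1 1 = 0 := by
    simp [hK, Matrix.mul_apply, Fin.sum_univ_two]; ring
  have h2 : K 0 0 * (X 0 0 - X 1 1) + K 0 1 * X 1 0 + K 1 0 * X 0 1 = 0 := by
    simp [hK, Matrix.mul_apply, Fin.sum_univ_two]; ring
  rw [Matrix.det_fin_two] at hX ⊢
  rw [Matrix.trace_fin_two, abs_lt] at ht
  have hD : (X 0 0 - X 1 1) ^ 2 + 4 * (X 0 1 * X 1 0) < 0 := by nlinarith
  have h11 : K 1 1 = - K 0 0 := by linarith
  rw [h11]
  generalize hk : K 0 0 = k at *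
  generalize hl : K 0 1 = l at *
  generalize hm : K 1 0 = m at *
  generalize X 0 0 = a at *
  generalize X 0 1 = b at *
  generalize X 1 0 = c at *
  generalize X 1 1 = d at *
  have hb : b ≠ 0 := by
    rintro rfl; nlinarith [sq_nonneg (a - d)]
  have key : b ^ 2 * (k ^ 2 + l * m) = (b * k - (a - d) / 2 * l) ^ 2
      - ((a - d) ^ 2 + 4 * (b * c)) / 4 * l ^ 2 := by
    linear_combination (b * l) * h2
  have hb2 : 0 < b ^ 2 := by positivity
  by_contra hcon
  have h3 : k ^ 2 + l * m ≤ 0 := by nlinarith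
  have h4 : b ^ 2 * (k ^ 2 + l * m) ≤ 0 := mul_nonpos_of_nonneg_of_nonpos hb2.le h3
  have hl0 : l = 0 := by
    by_contra hl0
    have : 0 < l ^ 2 := by positivity
    nlinarith [sq_nonneg (b * k - (a - d) / 2 * l)]
  subst hl0
  have hk0 : k = 0 := by
    have : (b * k) ^ 2 ≤ 0 := by nlinarith
    have : b * k = 0 := by nlinarith [sq_nonneg (b * k)]
    simpa [hb] using this
  subst hk0
  have hm0 : m = 0 := by
    simpa [hb] using h2
  subst hm0
  apply hK0
  ext i j
  fin_cases i <;> fin_cases j <;> simp_all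

lemma sl_parabolic_comm (X Y : Matrix (Fin 2) (Fin 2) ℝ) (hN : X.trace = 0) (hN2 : X.det = 0)
    (hY : Y.det = 1) (ht : |Y.trace| ≤ 2) (h0 : (X * Y).trace = 0) : X * Y = Y * X := by
  rw [Matrix.det_fin_two] at hN2 hY
  rw [Matrix.trace_fin_two] at hN ht
  simp only [Matrix.trace_fin_two, Matrix.mul_apply, Fin.sum_univ_two] at h0
  rw [abs_le] at ht
  have hD : (Y 0 0 - Y 1 1) ^ 2 + 4 * (Y 0 1 * Y 1 0) ≤ 0 := by nlinarith
  have h11 : X 1 1 = - X 0 0 := by linarith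
  suffices h : (X 0 1 * Y 1 0 - Y 0 1 * X 1 0 = 0) ∧
      (2 * X 0 0 * Y 0 1 + X 0 1 * (Y 1 1 - Y 0 0) = 0) ∧
      (X 1 0 * (Y 0 0 - Y 1 1) - 2 * X 0 0 * Y 1 0 = 0) by
    obtain ⟨e1, e2, e3⟩ := h
    ext i j
    fin_cases i <;> fin_cases j <;>
      simp only [Matrix.mul_apply, Fin.sum_univ_two, Fin.zero_eta, Fin.mk_one, h11] <;> linarith
  rw [h11] at h0 hN2
  generalize X 0 0 = p at *
  generalize X 0 1 = q at *
  generalize X 1 0 = r at *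
  generalize Y 0 0 = a at *
  generalize Y 0 1 = b at *
  generalize Y 1 0 = c at *
  generalize Y 1 1 = d at *
  by_cases hq : q = 0
  · subst hq
    have hp : p = 0 := by nlinarith
    subst hp
    by_cases hr : r = 0
    · subst hr; simp
    · have hb : b = 0 := by
        have : r * b = 0 := by linarith
        simpa [hr] using this
      subst hb
      have : a - d = 0 := by nlinarith
      refine ⟨by ring, by ring, by rw [this]; ring⟩
  · have hQ : c * q ^ 2 + (a - d) * q * p - b * p ^ 2 = 0 := by
      linear_combination q * h0 + b * hN2
    have g1 : (a - d) * q - 2 * b * p = 0 := by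
      have : ((a - d) * q - 2 * b * p) ^ 2 ≤ 0 := by
        have : ((a - d) * q - 2 * b * p) ^ 2 = -4 * b * (c * q ^ 2 + (a - d) * q * p - b * p ^ 2)
          + ((a - d) ^ 2 + 4 * (b * c)) * q ^ 2 := by ring
        rw [this, hQ]; nlinarith [sq_nonneg q]
      nlinarith
    have g2 : 2 * c * q + (a - d) * p = 0 := by
      have : (2 * c * q + (a - d) * p) ^ 2 ≤ 0 := by
        have : (2 * c * q + (a - d) * p) ^ 2 = 4 * c * (c * q ^ 2 + (a - d) * q * p - b * p ^ 2)
          + ((a - d) ^ 2 + 4 * (b * c)) * p ^ 2 := by ring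
        rw [this, hQ]; nlinarith [sq_nonneg p]
      nlinarith
    refine ⟨?_, by linarith, ?_⟩
    · apply mul_left_cancel₀ hq
      linear_combination q / 2 * g2 - p / 2 * g1 + b * hN2
    · apply mul_left_cancel₀ hq
      linear_combination -p * g2 - (a - d) * hN2



lemma sl_ch (X : Matrix (Fin 2) (Fin 2) ℝ) (hX : X.det = 1) :
    X * X = X.trace • X - 1 := by
  rw [Matrix.det_fin_two] at hX
  ext i j
  fin_cases i <;> fin_cases j <;>
    simp [Matrix.mul_apply, Fin.sum_univ_two, Matrix.trace_fin_two] <;> linarith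

lemma sl_adj_mem_closure (X : Matrix (Fin 2) (Fin 2) ℝ) (hX : X.det = 1)
    (ht : |X.trace| < 2) (S : Submonoid (Matrix (Fin 2) (Fin 2) ℝ)) (hS : X ∈ S) :
    X.adjugate ∈ closure (S : Set (Matrix (Fin 2) (Fin 2) ℝ)) := by
  set τ := X.trace with hτ
  have hpow : ∀ k : ℕ, ∃ p q : ℝ, X ^ (k + 1) = p • X - q • 1 ∧ p ^ 2 - τ * p * q + q ^ 2 = 1 := by
    intro k
    induction k with
    | zero => exact ⟨1, 0, by simp, by simp⟩
    | succ k ih =>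
      obtain ⟨p, q, h1, h2⟩ := ih
      refine ⟨τ * p - q, p, ?_, by nlinarith⟩
      rw [pow_succ, h1, sub_mul, smul_mul_assoc, sl_ch X hX, smul_mul_assoc, one_mul, ← hτ]
      module
  rw [abs_lt] at ht
  set B : ℝ := 1 / (1 - |τ| / 2) with hB
  have hτ2 : |τ| < 2 := abs_lt.mpr ht
  have hpos : 0 < 1 - |τ| / 2 := by linarith
  have hBpos : 0 < B := by positivity
  have hbd : ∀ p q : ℝ, p ^ 2 - τ * p * q + q ^ 2 = 1 → p ^ 2 + q ^ 2 ≤ B := by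
    intro p q h
    rw [hB, le_div_iff₀ hpos]
    have h3 : τ * (p * q) ≤ |τ| * (|p| * |q|) := by
      rw [← abs_mul, ← abs_mul]; exact le_abs_self _
    have h4 : |p| * |q| ≤ (p ^ 2 + q ^ 2) / 2 := by
      rw [← sq_abs p, ← sq_abs q]; nlinarith [sq_nonneg (|p| - |q|)]
    have h5 : |τ| * (|p| * |q|) ≤ |τ| * ((p ^ 2 + q ^ 2) / 2) :=
      mul_le_mul_of_nonneg_left h4 (abs_nonneg _)
    nlinarith
  let Φ : ℝ × ℝ → Matrix (Fin 2) (Fin 2) ℝ := fun z => z.1 • X - z.2 • 1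
  have hΦ : Continuous Φ := by
    unfold Φ; fun_prop
  have hcomp : IsCompact (Φ '' (Icc (-(B + 1)) (B + 1) ×ˢ Icc (-(B + 1)) (B + 1))) :=
    (isCompact_Icc.prod isCompact_Icc).image hΦ
  have hmem : ∀ k : ℕ, X ^ (k + 1) ∈ Φ '' (Icc (-(B + 1)) (B + 1) ×ˢ Icc (-(B + 1)) (B + 1)) := by
    intro k
    obtain ⟨p, q, h1, h2⟩ := hpow k
    have h3 := hbd p q h2
    refine ⟨(p, q), ⟨⟨?_, ?_⟩, ⟨?_, ?_⟩⟩, h1.symm⟩ <;> simp only <;> nlinarith [sq_nonneg p, sq_nonneg q]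
  haveI : FirstCountableTopology (Matrix (Fin 2) (Fin 2) ℝ) :=
    inferInstanceAs (FirstCountableTopology (Fin 2 → Fin 2 → ℝ))
  obtain ⟨Z, -, φ, hφ, hlim⟩ := hcomp.tendsto_subseq hmem
  have hadjc : Continuous (fun Y : Matrix (Fin 2) (Fin 2) ℝ => Y.adjugate) :=
    Continuous.matrix_adjugate continuous_id
  have hdetc : Continuous (fun Y : Matrix (Fin 2) (Fin 2) ℝ => Y.det) :=
    Continuous.matrix_det continuous_id
  have hZ : Z.det = 1 := by
    have := (hdetc.tendsto Z).comp hlim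
    refine tendsto_nhds_unique this ?_
    refine tendsto_const_nhds.congr ?_
    intro k; simp [hX]
  have hl1 : Tendsto (fun k => X ^ (φ (k + 1) + 1) * (X ^ (φ k + 1)).adjugate * X.adjugate) atTop
      (nhds (Z * Z.adjugate * X.adjugate)) := by
    have e1 : Tendsto (fun k => X ^ (φ (k + 1) + 1)) atTop (nhds Z) :=
      hlim.comp (tendsto_add_atTop_nat 1)
    have e2 : Tendsto (fun k => (X ^ (φ k + 1)).adjugate) atTop (nhds Z.adjugate) :=
      (hadjc.tendsto Z).comp hlim
    exact (e1.mul e2).mul tendsto_const_nhds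
  rw [Matrix.mul_adjugate, hZ, one_smul, one_mul] at hl1
  refine mem_closure_of_tendsto hl1 (Eventually.of_forall fun k => ?_)
  have hlt : φ k < φ (k + 1) := hφ (Nat.lt_succ_self k)
  obtain ⟨d, hd⟩ := Nat.exists_eq_add_of_lt hlt
  have : X ^ (φ (k + 1) + 1) * (X ^ (φ k + 1)).adjugate * X.adjugate = X ^ d := by
    have e : φ (k + 1) + 1 = d + 1 + (φ k + 1) := by omega
    rw [e, pow_add X (d + 1), mul_assoc (X ^ (d+1)), Matrix.mul_adjugate, Matrix.det_pow, hX, one_pow, one_smul,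
      mul_one, pow_succ, mul_assoc, Matrix.mul_adjugate, hX, one_smul, mul_one]
  simp only [SetLike.mem_coe]
  rw [this]
  exact pow_mem hS d

lemma sl_word_aux (X Y : Matrix (Fin 2) (Fin 2) ℝ) (hX : X.det = 1) (hY : Y.det = 1)
    (hXt : |X.trace| = 2) (hne : X * Y ≠ Y * X) (S : Submonoid (Matrix (Fin 2) (Fin 2) ℝ))
    (hXS : X ∈ S) (hYS : Y ∈ S) : ∃ Z ∈ S, 2 < |Z.trace| := by
  by_contra hcon
  push Not at hcon
  obtain ⟨σ, hσ2, hσ⟩ : ∃ σ : ℝ, σ * σ = 1 ∧ X.trace = 2 * σ := by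
    rcases (abs_eq (by norm_num : (0:ℝ) ≤ 2)).mp hXt with h | h
    · exact ⟨1, by norm_num, by linarith⟩
    · exact ⟨-1, by norm_num, by linarith⟩
  set N := σ • X - 1 with hN
  have hXN : X = σ • (1 + N) := by
    rw [hN, add_sub_cancel, smul_smul, hσ2, one_smul]
  have hNN : N * N = 0 := by
    rw [hN, sub_mul, mul_sub, smul_mul_smul_comm, hσ2, one_smul, sl_ch X hX, hσ]
    have : (2 * σ) • X = σ • X + σ • X := by rw [two_mul, add_smul]
    rw [this]; simp only [mul_one, one_mul]; abel
  have hNt : N.trace = 0 := by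
    rw [hN, Matrix.trace_sub, Matrix.trace_smul, hσ]; simp; linarith
  have hNd : N.det = 0 := by
    have : (N * N).det = 0 := by rw [hNN]; simp
    rw [Matrix.det_mul] at this; simpa using this
  have hpow : ∀ k : ℕ, X ^ k = σ ^ k • (1 + (k : ℝ) • N) := by
    intro k
    induction k with
    | zero => simp
    | succ k ih =>
      rw [pow_succ, ih, hXN, smul_mul_smul_comm, ← pow_succ]
      congr 1
      rw [add_mul, mul_add, mul_add, smul_mul_assoc, smul_mul_assoc, hNN]
      simp only [mul_one, one_mul, smul_zero, add_zero]
      push_cast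
      module
  have htr : (N * Y).trace = 0 := by
    by_contra h0
    obtain ⟨k, hk⟩ := exists_nat_gt (5 / |(N * Y).trace|)
    rw [div_lt_iff₀ (abs_pos.mpr h0)] at hk
    have h1 := hcon (X ^ k * Y) (mul_mem (pow_mem hXS k) hYS)
    have h2 := hcon Y hYS
    have hσk : |σ ^ k| = 1 := by
      rw [abs_pow]
      have : |σ| = 1 := by
        have : |σ| * |σ| = 1 := by rw [← abs_mul, hσ2]; simp
        nlinarith [abs_nonneg σ]
      rw [this, one_pow]
    rw [hpow, smul_mul_assoc, Matrix.trace_smul, smul_eq_mul, abs_mul, hσk, one_mul, add_mul,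
      one_mul, Matrix.trace_add, smul_mul_assoc, Matrix.trace_smul, smul_eq_mul] at h1
    have h3 : |(k : ℝ) * (N * Y).trace| = k * |(N * Y).trace| := by
      rw [abs_mul, abs_of_nonneg (Nat.cast_nonneg k)]
    have h4 : |(k : ℝ) * (N * Y).trace| ≤ |Y.trace + (k : ℝ) * (N * Y).trace| + |Y.trace| := by
      have := abs_sub (Y.trace + (k : ℝ) * (N * Y).trace) Y.trace
      simpa using this
    linarith
  have hc := sl_parabolic_comm N Y hNt hNd hY (hcon Y hYS) htr
  apply hne
  rw [hXN, smul_mul_assoc, add_mul, hc, mul_smul_comm, mul_add, one_mul, mul_one]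

lemma sl_word (X Y : Matrix (Fin 2) (Fin 2) ℝ) (hX : X.det = 1) (hY : Y.det = 1)
    (hne : X * Y ≠ Y * X) (S : Submonoid (Matrix (Fin 2) (Fin 2) ℝ))
    (hXS : X ∈ S) (hYS : Y ∈ S) : ∃ Z ∈ S, 2 < |Z.trace| := by
  by_cases h1 : 2 < |X.trace|
  · exact ⟨X, hXS, h1⟩
  by_cases h2 : 2 < |Y.trace|
  · exact ⟨Y, hYS, h2⟩
  rcases eq_or_lt_of_le (not_lt.mp h1) with h1 | h1
  · exact sl_word_aux X Y hX hY h1 hne S hXS hYS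
  rcases eq_or_lt_of_le (not_lt.mp h2) with h2 | h2
  · exact sl_word_aux Y X hY hX h2 hne.symm S hYS hXS
  have hdet := sl_elliptic_comm X Y hX h1 hne
  have htr := sl_commutator_trace X Y
  rw [hX, hY] at htr
  have hgt : 2 < (X * Y * X.adjugate * Y.adjugate).trace := by linarith
  have hmem : X * Y * X.adjugate * Y.adjugate ∈ S.topologicalClosure := by
    refine mul_mem (mul_mem (mul_mem ?_ ?_) ?_) ?_
    · exact S.le_topologicalClosure hXS
    · exact S.le_topologicalClosure hYS
    · exact sl_adj_mem_closure X hX h1 S hXS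
    · exact sl_adj_mem_closure Y hY h2 S hYS
  have hopen : IsOpen {Z : Matrix (Fin 2) (Fin 2) ℝ | 2 < Z.trace} :=
    isOpen_lt continuous_const (Continuous.matrix_trace continuous_id)
  obtain ⟨Z, hZ1, hZ2⟩ := mem_closure_iff.mp hmem _ hopen hgt
  exact ⟨Z, hZ2, lt_of_lt_of_le hZ1 (le_abs_self _)⟩

/-- Ordered products `f (n-1) * ... * f 0`. -/
def prodM (f : ℕ → Matrix (Fin 2) (Fin 2) ℝ) : ℕ → Matrix (Fin 2) (Fin 2) ℝ
  | 0 => 1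
  | n + 1 => f n * prodM f n

lemma prodM_congr {f g : ℕ → Matrix (Fin 2) (Fin 2) ℝ} {n : ℕ} (h : ∀ j < n, f j = g j) :
    prodM f n = prodM g n := by
  induction n with
  | zero => rfl
  | succ n ih =>
    simp only [prodM]
    rw [h n (Nat.lt_succ_self n), ih (fun j hj => h j (by omega))]

lemma prodM_add (f : ℕ → Matrix (Fin 2) (Fin 2) ℝ) (m n : ℕ) :
    prodM f (m + n) = prodM (fun j => f (m + j)) n * prodM f m := by
  induction n with
  | zero => simp [prodM]
  | succ n ih => rw [← add_assoc]; simp only [prodM]; rw [ih, mul_assoc]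

lemma prodM_det {f : ℕ → Matrix (Fin 2) (Fin 2) ℝ} (h : ∀ j, (f j).det = 1) (n : ℕ) :
    (prodM f n).det = 1 := by
  induction n with
  | zero => simp [prodM]
  | succ n ih => simp [prodM, h, ih]

lemma sl_word_fun (F : Bool → Matrix (Fin 2) (Fin 2) ℝ) (hF : ∀ b, (F b).det = 1)
    (hne : F true * F false ≠ F false * F true) :
    ∃ (n : ℕ) (c : ℕ → Bool), 0 < n ∧ 2 < |(prodM (fun j => F (c j)) n).trace| := by
  let S : Submonoid (Matrix (Fin 2) (Fin 2) ℝ) :=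
    { carrier := {Z | ∃ (n : ℕ) (c : ℕ → Bool), Z = prodM (fun j => F (c j)) n}
      one_mem' := ⟨0, fun _ => true, rfl⟩
      mul_mem' := by
        rintro _ _ ⟨n, c, rfl⟩ ⟨m, d, rfl⟩
        refine ⟨m + n, fun j => if j < m then d j else c (j - m), ?_⟩
        rw [prodM_add]
        congr 1
        · apply prodM_congr; intro j _; simp
        · apply prodM_congr; intro j hj; simp [hj] }
  have hmem : ∀ b, F b ∈ S := fun b => ⟨1, fun _ => b, by simp [prodM]⟩
  obtain ⟨Z, ⟨n, c, rfl⟩, hZ⟩ := sl_word (F true) (F false) (hF _) (hF _) hne S (hmem _) (hmem _)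
  refine ⟨n, c, ?_, hZ⟩
  rcases Nat.eq_zero_or_pos n with h | h
  · subst h; simp [prodM] at hZ
  · exact h



/-! ### Part B: ODE and transfer matrices -/

/-- A `C²` function on `[0,T]` with its derivatives. -/
structure C2on (T : ℝ) (u u1 u2 : ℝ → ℝ) : Prop where
  cu : ContinuousOn u (Icc 0 T)
  cu1 : ContinuousOn u1 (Icc 0 T)
  cu2 : ContinuousOn u2 (Icc 0 T)
  d1 : ∀ x ∈ Ioo 0 T, HasDerivAt u (u1 x) x
  d2 : ∀ x ∈ Ioo 0 T, HasDerivAt u1 (u2 x) x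

lemma clip_abs_le {B x : ℝ} (hB : 0 ≤ B) : |max (-B) (min B x)| ≤ |x| := by
  rw [abs_le]
  constructor
  · rcases le_total B x with h | h
    · rw [min_eq_left h, max_eq_right (by linarith)]
      linarith [abs_nonneg x]
    · rw [min_eq_right h]
      exact (neg_abs_le x).trans (le_max_right _ _)
  · apply max_le
    · linarith [abs_nonneg x]
    · exact (min_le_right _ _).trans (le_abs_self x)

lemma clip_abs_le' {B x : ℝ} (hB : 0 ≤ B) : |max (-B) (min B x)| ≤ B := by
  rw [abs_le]
  exact ⟨le_max_left _ _, max_le (by linarith) (min_le_left _ _)⟩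

lemma clip_eq {B x : ℝ} (hx : |x| ≤ B) : max (-B) (min B x) = x := by
  rw [abs_le] at hx
  rw [min_eq_right hx.2, max_eq_right hx.1]

lemma clip_lip (B x y : ℝ) : |max (-B) (min B x) - max (-B) (min B y)| ≤ |x - y| := by
  have h : LipschitzWith 1 (fun x : ℝ => max (-B) (min B x)) :=
    (LipschitzWith.id.const_min B).const_max (-B)
  have := h.dist_le_mul x y
  simpa [Real.dist_eq] using this

lemma ode_exists {q : ℝ → ℝ} (hq : Continuous q) {T : ℝ} (hT : 0 < T) {K : ℝ} (hK1 : 1 ≤ K)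
    (hK : ∀ x ∈ Icc 0 T, |q x| ≤ K) (α β : ℝ) :
    ∃ u u1 : ℝ → ℝ, C2on T u u1 (fun x => q x * u x) ∧ u 0 = α ∧ u1 0 = β ∧
      ∀ x ∈ Icc 0 T, |u x| ≤ max |α| |β| * Real.exp (K * T) ∧
        |u1 x| ≤ max |α| |β| * Real.exp (K * T) := by
  set m := max |α| |β| with hm
  set B := m * Real.exp (K * T) with hB
  have hm0 : 0 ≤ m := le_max_of_le_left (abs_nonneg _)
  have hB0 : 0 ≤ B := by positivity
  have hK0 : 0 ≤ K := by linarith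
  let cl : ℝ → ℝ := fun x => max (-B) (min B x)
  let f : ℝ → ℝ × ℝ → ℝ × ℝ := fun t z => (cl z.2, q t * cl z.1)
  have h0 : (0:ℝ) ∈ Icc 0 T := ⟨le_rfl, hT.le⟩
  have hfb : ∀ t ∈ Icc 0 T, ∀ z, ‖f t z‖ ≤ K * ‖z‖ := by
    intro t ht z
    rw [Prod.norm_def]
    simp only [f, cl, Real.norm_eq_abs]
    have h1 : |z.1| ≤ ‖z‖ := norm_fst_le z
    have h2 : |z.2| ≤ ‖z‖ := norm_snd_le z
    apply max_le
    · calc _ ≤ |z.2| := clip_abs_le hB0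
        _ ≤ ‖z‖ := h2
        _ ≤ K * ‖z‖ := by nlinarith [norm_nonneg z]
    · rw [abs_mul]
      exact mul_le_mul (hK t ht) ((clip_abs_le hB0).trans h1) (abs_nonneg _) hK0
  have hPL : IsPicardLindelof f (⟨0, h0⟩ : Icc (0:ℝ) T) (α, β)
      ⟨K * B * T, by positivity⟩ 0 ⟨K * B, by positivity⟩ ⟨K, hK0⟩ := by
    refine ⟨?_, ?_, ?_, ?_⟩
    · intro t ht
      apply LipschitzWith.lipschitzOnWith
      refine LipschitzWith.of_dist_le_mul fun z w => ?_
      rw [Prod.dist_eq, Prod.dist_eq]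
      simp only [f, NNReal.coe_mk, Real.dist_eq]
      have e1 : |z.1 - w.1| ≤ max |z.1 - w.1| |z.2 - w.2| := le_max_left _ _
      have e2 : |z.2 - w.2| ≤ max |z.1 - w.1| |z.2 - w.2| := le_max_right _ _
      have e0 : 0 ≤ max |z.1 - w.1| |z.2 - w.2| := (abs_nonneg _).trans e1
      apply max_le
      · calc _ ≤ |z.2 - w.2| := clip_lip B _ _
          _ ≤ _ := e2
          _ ≤ _ := le_mul_of_one_le_left e0 hK1
      · rw [← mul_sub, abs_mul]
        exact mul_le_mul (hK t ht) ((clip_lip B _ _).trans e1) (abs_nonneg _) hK0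
    · intro z _
      simp only [f]
      fun_prop
    · intro t ht z _
      rw [Prod.norm_def]
      simp only [f, cl, Real.norm_eq_abs, NNReal.coe_mk]
      apply max_le
      · exact (clip_abs_le' hB0).trans (le_mul_of_one_le_left hB0 hK1)
      · rw [abs_mul]
        exact mul_le_mul (hK t ht) (clip_abs_le' hB0) (abs_nonneg _) hK0
    · simp only [max_eq_left, sub_zero, sub_self, NNReal.coe_mk, NNReal.coe_zero, hT.le]; exact le_rfl
  obtain ⟨γ, hγ0, hγ⟩ := hPL.exists_eq_forall_mem_Icc_hasDerivWithinAt₀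
  simp only at hγ0
  have hcont : ContinuousOn γ (Icc 0 T) := fun t ht => (hγ t ht).continuousWithinAt
  have hbound : ∀ x ∈ Icc 0 T, ‖γ x‖ ≤ B := by
    intro x hx
    have := norm_le_gronwallBound_of_norm_deriv_right_le (f := γ) (f' := fun t => f t (γ t))
      (δ := m) (K := K) (ε := 0) (a := 0) (b := T) hcont
      (fun t ht => by
        have h1 := hγ t ⟨ht.1, ht.2.le⟩
        have h2 : HasDerivWithinAt γ (f t (γ t)) (Icc t T) t :=
          h1.mono (Icc_subset_Icc ht.1 le_rfl)
        exact h2.mono_of_mem_nhdsWithin (Icc_mem_nhdsGE ht.2))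
      (by rw [hγ0, Prod.norm_def]; simp [hm])
      (fun t ht => by simpa using hfb t ⟨ht.1, ht.2.le⟩ (γ t)) x hx
    rw [gronwallBound_ε0, sub_zero] at this
    refine this.trans ?_
    rw [hB]
    gcongr
    exact hx.2
  have hb1 : ∀ x ∈ Icc 0 T, |(γ x).1| ≤ B := fun x hx => (norm_fst_le (γ x)).trans (hbound x hx)
  have hb2 : ∀ x ∈ Icc 0 T, |(γ x).2| ≤ B := fun x hx => (norm_snd_le (γ x)).trans (hbound x hx)
  have hder : ∀ x ∈ Ioo 0 T, HasDerivAt γ ((γ x).2, q x * (γ x).1) x := by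
    intro x hx
    have hx' : x ∈ Icc 0 T := Ioo_subset_Icc_self hx
    have h1 := (hγ x hx').hasDerivAt (Icc_mem_nhds hx.1 hx.2)
    have : f x (γ x) = ((γ x).2, q x * (γ x).1) := by
      simp only [f, cl]
      rw [clip_eq (hb1 x hx'), clip_eq (hb2 x hx')]
    rwa [this] at h1
  refine ⟨fun x => (γ x).1, fun x => (γ x).2, ⟨hcont.fst, hcont.snd, hq.continuousOn.mul hcont.fst, ?_, ?_⟩, by simp [hγ0], by simp [hγ0], fun x hx => ⟨hb1 x hx, hb2 x hx⟩⟩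
  · intro x hx
    exact hasFDerivAt_fst.comp_hasDerivAt x (hder x hx)
  · intro x hx
    exact hasFDerivAt_snd.comp_hasDerivAt x (hder x hx)

lemma wronskian_ftc {T : ℝ} (hT : 0 < T) {u u1 u2 v v1 v2 : ℝ → ℝ} (hu : C2on T u u1 u2)
    (hv : C2on T v v1 v2) {a b : ℝ} (ha : 0 ≤ a) (hab : a ≤ b) (hb : b ≤ T) :
    ∫ x in a..b, (u x * v2 x - u2 x * v x) = (u b * v1 b - u1 b * v b) - (u a * v1 a - u1 a * v a) := by
  have hsub : Icc a b ⊆ Icc 0 T := Icc_subset_Icc ha hb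
  have c1 : ContinuousOn (fun x => u x * v2 x - u2 x * v x) (Icc a b) :=
    ((hu.cu.mul hv.cu2).sub (hu.cu2.mul hv.cu)).mono hsub
  rw [intervalIntegral.integral_eq_sub_of_hasDerivAt_of_le (f := fun x => u x * v1 x - u1 x * v x) hab
    (((hu.cu.mul hv.cu1).sub (hu.cu1.mul hv.cu)).mono hsub)]
  · intro x hx
    have hx' : x ∈ Ioo 0 T := ⟨lt_of_le_of_lt ha hx.1, lt_of_lt_of_le hx.2 hb⟩
    have := ((hu.d1 x hx').mul (hv.d2 x hx')).sub ((hu.d2 x hx').mul (hv.d1 x hx'))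
    convert! this using 1
    ring
  · exact (c1.mono (by rw [uIcc_of_le hab])).intervalIntegrable

/-- `M` is the transfer matrix of `-u'' + q u = 0` over `[0,T]`, quantitatively. -/
def IsTransfer (T : ℝ) (q : ℝ → ℝ) (M : Matrix (Fin 2) (Fin 2) ℝ) : Prop :=
  M.det = 1 ∧ ∀ K : ℝ, 1 ≤ K → (∀ x ∈ Icc 0 T, |q x| ≤ K) → ∀ u u1 u2 : ℝ → ℝ, C2on T u u1 u2 →
    |u T - (M 0 0 * u 0 + M 0 1 * u1 0)| ≤
        2 * Real.exp (K * T) ^ 2 * ∫ x in (0:ℝ)..T, |u2 x - q x * u x| ∧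
    |u1 T - (M 1 0 * u 0 + M 1 1 * u1 0)| ≤
        2 * Real.exp (K * T) ^ 2 * ∫ x in (0:ℝ)..T, |u2 x - q x * u x|

lemma IsTransfer.exact {T : ℝ} {q : ℝ → ℝ} (hq : Continuous q)
    {M : Matrix (Fin 2) (Fin 2) ℝ} (h : IsTransfer T q M) {u u1 : ℝ → ℝ}
    (hu : C2on T u u1 (fun x => q x * u x)) :
    u T = M 0 0 * u 0 + M 0 1 * u1 0 ∧ u1 T = M 1 0 * u 0 + M 1 1 * u1 0 := by
  obtain ⟨K, hK⟩ := (isCompact_Icc (a := (0:ℝ)) (b := T)).exists_bound_of_continuousOn hq.continuousOn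
  have := h.2 (max K 1) (le_max_right _ _) (fun x hx => (hK x hx).trans (le_max_left _ _)) u u1 _ hu
  simp only [sub_self, abs_zero, intervalIntegral.integral_zero, mul_zero] at this
  constructor
  · have h1 := abs_nonpos_iff.mp this.1; linarith
  · have h1 := abs_nonpos_iff.mp this.2; linarith

lemma exists_transfer {T : ℝ} (hT : 0 < T) {q : ℝ → ℝ} (hq : Continuous q) :
    ∃ M, IsTransfer T q M := by
  obtain ⟨K₀, hK₀⟩ := (isCompact_Icc (a := (0:ℝ)) (b := T)).exists_bound_of_continuousOn hq.continuousOn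
  have key : ∀ K : ℝ, 1 ≤ K → (∀ x ∈ Icc 0 T, |q x| ≤ K) → ∃ M : Matrix (Fin 2) (Fin 2) ℝ,
      M.det = 1 ∧ ∀ u u1 u2 : ℝ → ℝ, C2on T u u1 u2 →
    |u T - (M 0 0 * u 0 + M 0 1 * u1 0)| ≤
        2 * Real.exp (K * T) ^ 2 * ∫ x in (0:ℝ)..T, |u2 x - q x * u x| ∧
    |u1 T - (M 1 0 * u 0 + M 1 1 * u1 0)| ≤
        2 * Real.exp (K * T) ^ 2 * ∫ x in (0:ℝ)..T, |u2 x - q x * u x| := by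
    intro K hK1 hK
    obtain ⟨φ, φ', hφ, hφ0, hφ'0, hφb⟩ := ode_exists hq hT hK1 hK 1 0
    obtain ⟨χ, χ', hχ, hχ0, hχ'0, hχb⟩ := ode_exists hq hT hK1 hK 0 1
    simp only [abs_one, abs_zero, zero_le_one, sup_of_le_left, sup_of_le_right, one_mul] at hφb hχb
    set C := Real.exp (K * T) with hC
    have hC0 : 0 ≤ C := (Real.exp_pos _).le
    have hTm : T ∈ Icc 0 T := ⟨hT.le, le_rfl⟩
    have hW : φ T * χ' T - φ' T * χ T = 1 := by
      have := wronskian_ftc hT hφ hχ le_rfl hT.le le_rfl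
      have h2 : ∀ x, φ x * (q x * χ x) - q x * φ x * χ x = 0 := fun x => by ring
      simp only [h2, intervalIntegral.integral_zero, hφ0, hφ'0, hχ0, hχ'0] at this
      linarith
    refine ⟨!![φ T, χ T; φ' T, χ' T], by rw [Matrix.det_fin_two_of]; linarith, ?_⟩
    intro u u1 u2 hu
    set I := ∫ x in (0:ℝ)..T, |u2 x - q x * u x| with hI
    have hfc : ContinuousOn (fun x => u2 x - q x * u x) (Icc 0 T) :=
      hu.cu2.sub (hq.continuousOn.mul hu.cu)
    have hest : ∀ v v1 : ℝ → ℝ, C2on T v v1 (fun x => q x * v x) → (∀ x ∈ Icc 0 T, |v x| ≤ C) →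
        |(u T * v1 T - u1 T * v T) - (u 0 * v1 0 - u1 0 * v 0)| ≤ C * I := by
      intro v v1 hv hvb
      rw [← wronskian_ftc hT hu hv le_rfl hT.le le_rfl, hI, ← intervalIntegral.integral_const_mul]
      refine (intervalIntegral.abs_integral_le_integral_abs hT.le).trans ?_
      apply intervalIntegral.integral_mono_on hT.le
      · apply ContinuousOn.intervalIntegrable
        rw [uIcc_of_le hT.le]
        exact ((hu.cu.mul hv.cu2).sub (hu.cu2.mul hv.cu)).abs
      · apply ContinuousOn.intervalIntegrable
        rw [uIcc_of_le hT.le]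
        exact continuousOn_const.mul hfc.abs
      · intro x hx
        have : u x * (q x * v x) - u2 x * v x = -(v x * (u2 x - q x * u x)) := by ring
        rw [this, abs_neg, abs_mul]
        exact mul_le_mul_of_nonneg_right (hvb x hx) (abs_nonneg _)
    have e1 := hest φ φ' hφ (fun x hx => (hφb x hx).1)
    have e2 := hest χ χ' hχ (fun x hx => (hχb x hx).1)
    simp only [hφ0, hφ'0, hχ0, hχ'0] at e1 e2
    set d1 := u T * φ' T - u1 T * φ T - (u 0 * 0 - u1 0 * 1) with hd1
    set d2 := u T * χ' T - u1 T * χ T - (u 0 * 1 - u1 0 * 0) with hd2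
    have hfin : ∀ a b : ℝ, |a| ≤ C → |b| ≤ C → |a * d2 - b * d1| ≤ 2 * C ^ 2 * I := by
      intro a b ha hb
      calc |a * d2 - b * d1| ≤ |a * d2| + |b * d1| := abs_sub _ _
        _ = |a| * |d2| + |b| * |d1| := by rw [abs_mul, abs_mul]
        _ ≤ C * (C * I) + C * (C * I) := by gcongr
        _ = _ := by ring
    constructor
    · have := hfin (φ T) (χ T) (hφb T hTm).1 (hχb T hTm).1
      convert this using 2
      simp
      linear_combination (-u T) * hW
    · have := hfin (φ' T) (χ' T) (hφb T hTm).2 (hχb T hTm).2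
      convert this using 2
      simp
      linear_combination (-u1 T) * hW
  obtain ⟨M, hM1, hM2⟩ := key (max K₀ 1) (le_max_right _ _) (fun x hx => (hK₀ x hx).trans (le_max_left _ _))
  have hMe : ∀ u u1 : ℝ → ℝ, C2on T u u1 (fun x => q x * u x) →
    u T = M 0 0 * u 0 + M 0 1 * u1 0 ∧ u1 T = M 1 0 * u 0 + M 1 1 * u1 0 := by
    intro u u1 hu
    have := hM2 u u1 _ hu
    simp only [sub_self, abs_zero, intervalIntegral.integral_zero, mul_zero] at this
    constructor
    · have h1 := abs_nonpos_iff.mp this.1; linarith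
    · have h1 := abs_nonpos_iff.mp this.2; linarith
  refine ⟨M, hM1, ?_⟩
  intro K hK1 hK
  obtain ⟨M', h1, h2⟩ := key K hK1 hK
  have : M = M' := by
    obtain ⟨φ, φ', hφ, hφ0, hφ'0, hφb⟩ := ode_exists hq hT hK1 hK 1 0
    obtain ⟨χ, χ', hχ, hχ0, hχ'0, hχb⟩ := ode_exists hq hT hK1 hK 0 1
    have a1 := hMe _ _ hφ
    have a2 := hMe _ _ hχ
    have b1 := h2 _ _ _ hφ
    have b2 := h2 _ _ _ hχ
    simp only [sub_self, abs_zero, intervalIntegral.integral_zero, mul_zero, abs_nonpos_iff] at b1 b2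
    rw [hφ0, hφ'0] at a1 b1
    rw [hχ0, hχ'0] at a2 b2
    ext i j
    fin_cases i <;> fin_cases j <;> simp only [Fin.zero_eta, Fin.mk_one] <;> linarith [a1.1, a1.2, a2.1, a2.2, b1.1, b1.2, b2.1, b2.2]
  rw [this]
  exact h2

open Classical in
/-- The transfer matrix over `[0,T]`. -/
def TM (T : ℝ) (q : ℝ → ℝ) : Matrix (Fin 2) (Fin 2) ℝ :=
  if h : ∃ M, IsTransfer T q M then h.choose else 1

lemma TM_spec {T : ℝ} (hT : 0 < T) {q : ℝ → ℝ} (hq : Continuous q) : IsTransfer T q (TM T q) := by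
  have h := exists_transfer hT hq
  rw [TM, dif_pos h]
  exact h.choose_spec

lemma TM_det {T : ℝ} (hT : 0 < T) {q : ℝ → ℝ} (hq : Continuous q) : (TM T q).det = 1 :=
  (TM_spec hT hq).1

/-- Lipschitz dependence of the transfer matrix on the potential. -/
lemma TM_lip {T : ℝ} (hT : 0 < T) {q q' : ℝ → ℝ} (hq : Continuous q) (hq' : Continuous q')
    {K κ : ℝ} (hK1 : 1 ≤ K) (hK : ∀ x ∈ Icc 0 T, |q x| ≤ K) (hK' : ∀ x ∈ Icc 0 T, |q' x| ≤ K)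
    (hκ : ∀ x ∈ Icc 0 T, |q' x - q x| ≤ κ) (i j : Fin 2) :
    |TM T q' i j - TM T q i j| ≤ 2 * Real.exp (K * T) ^ 3 * T * κ := by
  have hκ0 : 0 ≤ κ := (abs_nonneg _).trans (hκ 0 ⟨le_rfl, hT.le⟩)
  have hmain : ∀ u u1 : ℝ → ℝ, C2on T u u1 (fun x => q' x * u x) →
      (∀ x ∈ Icc 0 T, |u x| ≤ Real.exp (K * T)) →
      2 * Real.exp (K * T) ^ 2 * ∫ x in (0:ℝ)..T, |q' x * u x - q x * u x| ≤
        2 * Real.exp (K * T) ^ 3 * T * κ := by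
    intro u u1 hu hb
    have : ∫ x in (0:ℝ)..T, |q' x * u x - q x * u x| ≤ ∫ x in (0:ℝ)..T, κ * Real.exp (K * T) := by
      apply intervalIntegral.integral_mono_on hT.le
      · apply ContinuousOn.intervalIntegrable
        rw [uIcc_of_le hT.le]
        exact ((hq'.continuousOn.mul hu.cu).sub (hq.continuousOn.mul hu.cu)).abs
      · simp
      · intro x hx
        rw [← sub_mul, abs_mul]
        exact mul_le_mul (hκ x hx) (hb x hx) (abs_nonneg _) hκ0
    rw [intervalIntegral.integral_const, smul_eq_mul, sub_zero] at this
    calc _ ≤ 2 * Real.exp (K * T) ^ 2 * (T * (κ * Real.exp (K * T))) := by gcongr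
      _ = _ := by ring
  obtain ⟨φ, φ', hφ, hφ0, hφ'0, hφb⟩ := ode_exists hq' hT hK1 hK' 1 0
  obtain ⟨χ, χ', hχ, hχ0, hχ'0, hχb⟩ := ode_exists hq' hT hK1 hK' 0 1
  simp only [abs_one, abs_zero, zero_le_one, sup_of_le_left, sup_of_le_right, one_mul] at hφb hχb
  have a1 := (TM_spec hT hq').exact hq' hφ
  have a2 := (TM_spec hT hq').exact hq' hχ
  have b1 := (TM_spec hT hq).2 K hK1 hK _ _ _ hφ
  have b2 := (TM_spec hT hq).2 K hK1 hK _ _ _ hχ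
  have m1 := hmain _ _ hφ (fun x hx => (hφb x hx).1)
  have m2 := hmain _ _ hχ (fun x hx => (hχb x hx).1)
  rw [hφ0, hφ'0] at a1 b1
  rw [hχ0, hχ'0] at a2 b2
  simp only [mul_one, mul_zero, add_zero, zero_add] at a1 a2 b1 b2
  rw [a1.1, a1.2] at b1
  rw [a2.1, a2.2] at b2
  fin_cases i <;> fin_cases j
  · exact b1.1.trans m1
  · exact b2.1.trans m2
  · exact b1.2.trans m1
  · exact b2.2.trans m2



/-! ### Part D: noncommuting transfer matrices -/

lemma near_zero {T K C b : ℝ} (hK1 : 1 ≤ K) (hC1 : 1 ≤ C) (hbT : b ≤ T) (hb : K * C * b ≤ 1 / 2)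
    {q u u1 : ℝ → ℝ} (hK : ∀ x ∈ Icc 0 T, |q x| ≤ K) (hu : C2on T u u1 (fun x => q x * u x))
    (hb1 : ∀ x ∈ Icc 0 T, |u x| ≤ C) (hb2 : ∀ x ∈ Icc 0 T, |u1 x| ≤ C) :
    (u 0 = 1 → ∀ x ∈ Icc 0 b, 1 / 2 ≤ u x ∧ u x ≤ 3 / 2) ∧
    (u 0 = 0 → u1 0 = 1 → ∀ x ∈ Icc 0 b, x / 2 ≤ u x ∧ u x ≤ 3 / 2 * x) := by
  have mvt : ∀ f f' : ℝ → ℝ, ContinuousOn f (Icc 0 T) → (∀ x ∈ Ioo 0 T, HasDerivAt f (f' x) x) →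
      ∀ x ∈ Ioc 0 b, ∃ c ∈ Ioo 0 x, f x = f 0 + f' c * x := by
    intro f f' hf hd x hx
    obtain ⟨c, hc, h⟩ := exists_hasDerivAt_eq_slope f f' hx.1
      (hf.mono (Icc_subset_Icc le_rfl (hx.2.trans hbT)))
      (fun y hy => hd y ⟨hy.1, hy.2.trans_le (hx.2.trans hbT)⟩)
    refine ⟨c, hc, ?_⟩
    rw [h, sub_zero, div_mul_cancel₀ _ hx.1.ne']
    ring
  have hKC : 1 ≤ K * C := one_le_mul_of_one_le_of_one_le hK1 hC1
  constructor
  · intro h0 x hx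
    rcases eq_or_lt_of_le hx.1 with h | h
    · rw [← h, h0]; norm_num
    · obtain ⟨c, hc, e⟩ := mvt u u1 hu.cu hu.d1 x ⟨h, hx.2⟩
      have h1 : |u1 c| ≤ C := hb2 c ⟨hc.1.le, hc.2.le.trans (hx.2.trans hbT)⟩
      have h2 : |u1 c * x| ≤ 1 / 2 := by
        rw [abs_mul, abs_of_pos h]
        calc |u1 c| * x ≤ C * b := mul_le_mul h1 hx.2 h.le (by linarith)
          _ ≤ K * C * b := by
            have : 0 ≤ C * b := mul_nonneg (by linarith) (h.le.trans hx.2)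
            nlinarith
          _ ≤ _ := hb
      rw [abs_le] at h2
      rw [e, h0]
      constructor <;> linarith [h2.1, h2.2]
  · intro h0 h0' x hx
    rcases eq_or_lt_of_le hx.1 with h | h
    · rw [← h, h0]; norm_num
    · obtain ⟨c, hc, e⟩ := mvt u u1 hu.cu hu.d1 x ⟨h, hx.2⟩
      obtain ⟨d, hd, e'⟩ := mvt u1 _ hu.cu1 hu.d2 c ⟨hc.1, hc.2.le.trans hx.2⟩
      have hdT : d ∈ Icc 0 T := ⟨hd.1.le, hd.2.le.trans (hc.2.le.trans (hx.2.trans hbT))⟩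
      have h2 : |q d * u d * c| ≤ 1 / 2 := by
        rw [abs_mul, abs_of_pos hc.1, abs_mul]
        calc |q d| * |u d| * c ≤ K * C * b := by
              refine mul_le_mul (mul_le_mul (hK d hdT) (hb1 d hdT) (abs_nonneg _) (by linarith))
                (hc.2.le.trans hx.2) hc.1.le (by linarith)
          _ ≤ _ := hb
      rw [abs_le] at h2
      rw [e, h0, e', h0']
      constructor <;> nlinarith [h2.1, h2.2]

set_option maxHeartbeats 1000000 in
lemma bump_entries {T K b : ℝ} (hT : 0 < T) (hK1 : 1 ≤ K) (hbT : b ≤ T)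
    (hb : K * Real.exp (K * T) * b ≤ 1 / 2)
    {q w : ℝ → ℝ} (hq : Continuous q) (hw : Continuous w)
    (hK : ∀ x ∈ Icc 0 T, |q x| ≤ K) (hK' : ∀ x ∈ Icc 0 T, |q x + w x| ≤ K)
    {a c : ℝ} (ha : 0 ≤ a) (hac : a < c) (hcb : c ≤ b) (hw0 : ∀ x, 0 ≤ w x)
    (hwz : ∀ x, x ∉ Ioo a c → w x = 0) (hwp : ∀ x ∈ Ioo a c, 0 < w x) :
    ∃ P Z : ℝ, ((TM T q).adjugate * TM T (fun x => q x + w x)) 1 0 = P ∧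
      ((TM T q).adjugate * TM T (fun x => q x + w x)) 0 1 = -Z ∧ 0 < P ∧ a ^ 2 * P ≤ 9 * Z ∧
      Z ≤ 9 * c ^ 2 * P := by
  have hq' : Continuous (fun x => q x + w x) := hq.add hw
  obtain ⟨φ, φ', hφ, hφ0, hφ'0, hφb⟩ := ode_exists hq hT hK1 hK 1 0
  obtain ⟨χ, χ', hχ, hχ0, hχ'0, hχb⟩ := ode_exists hq hT hK1 hK 0 1
  obtain ⟨f, f', hf, hf0, hf'0, hfb⟩ := ode_exists hq' hT hK1 hK' 1 0
  obtain ⟨g, g', hg, hg0, hg'0, hgb⟩ := ode_exists hq' hT hK1 hK' 0 1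
  simp only [abs_one, abs_zero, zero_le_one, sup_of_le_left, sup_of_le_right, one_mul] at hφb hχb hfb hgb
  have hC1 : 1 ≤ Real.exp (K * T) := Real.one_le_exp (by positivity)
  have nφ := (near_zero hK1 hC1 hbT hb hK hφ (fun x hx => (hφb x hx).1) (fun x hx => (hφb x hx).2)).1 hφ0
  have nχ := (near_zero hK1 hC1 hbT hb hK hχ (fun x hx => (hχb x hx).1) (fun x hx => (hχb x hx).2)).2 hχ0 hχ'0
  have nf := (near_zero hK1 hC1 hbT hb hK' hf (fun x hx => (hfb x hx).1) (fun x hx => (hfb x hx).2)).1 hf0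
  have ng := (near_zero hK1 hC1 hbT hb hK' hg (fun x hx => (hgb x hx).1) (fun x hx => (hgb x hx).2)).2 hg0 hg'0
  have a1 := (TM_spec hT hq).exact hq hφ
  have a2 := (TM_spec hT hq).exact hq hχ
  have b1 := (TM_spec hT hq').exact hq' hf
  have b2 := (TM_spec hT hq').exact hq' hg
  rw [hφ0, hφ'0] at a1
  rw [hχ0, hχ'0] at a2
  rw [hf0, hf'0] at b1
  rw [hg0, hg'0] at b2
  simp only [mul_one, mul_zero, add_zero, zero_add] at a1 a2 b1 b2
  have w1 := wronskian_ftc hT hφ hf le_rfl hT.le le_rfl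
  have w2 := wronskian_ftc hT hχ hg le_rfl hT.le le_rfl
  have e1 : ∀ x, φ x * ((q x + w x) * f x) - q x * φ x * f x = w x * (φ x * f x) := fun x => by ring
  have e2 : ∀ x, χ x * ((q x + w x) * g x) - q x * χ x * g x = w x * (χ x * g x) := fun x => by ring
  simp only [e1, e2, hφ0, hφ'0, hχ0, hχ'0, hf0, hf'0, hg0, hg'0] at w1 w2
  set P := ∫ x in (0:ℝ)..T, w x * (φ x * f x) with hP
  set Z := ∫ x in (0:ℝ)..T, w x * (χ x * g x) with hZ
  set I := ∫ x in (0:ℝ)..T, w x with hI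
  have iI : IntervalIntegrable w volume 0 T := hw.intervalIntegrable _ _
  have iP : IntervalIntegrable (fun x => w x * (φ x * f x)) volume 0 T := by
    apply ContinuousOn.intervalIntegrable
    rw [uIcc_of_le hT.le]
    exact hw.continuousOn.mul (hφ.cu.mul hf.cu)
  have iZ : IntervalIntegrable (fun x => w x * (χ x * g x)) volume 0 T := by
    apply ContinuousOn.intervalIntegrable
    rw [uIcc_of_le hT.le]
    exact hw.continuousOn.mul (hχ.cu.mul hg.cu)
  have hI0 : 0 < I := by
    have hs : 0 < ∫ x in a..c, w x := intervalIntegral.intervalIntegral_pos_of_pos_on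
      (hw.intervalIntegrable _ _) hwp hac
    refine hs.trans_le ?_
    exact intervalIntegral.integral_mono_interval ha hac.le (hcb.trans hbT)
      (Eventually.of_forall hw0) iI
  have hlow : ∀ (k : ℝ) (h : ℝ → ℝ), (∀ x ∈ Ioo a c, k ≤ h x) → IntervalIntegrable (fun x => w x * h x) volume 0 T →
      k * I ≤ ∫ x in (0:ℝ)..T, w x * h x := by
    intro k h hk hi
    rw [hI, ← intervalIntegral.integral_const_mul]
    apply intervalIntegral.integral_mono_on hT.le (iI.const_mul k) hi
    intro x _
    by_cases hx : x ∈ Ioo a c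
    · nlinarith [hk x hx, hw0 x]
    · rw [hwz x hx]; simp
  have hup : ∀ (k : ℝ) (h : ℝ → ℝ), (∀ x ∈ Ioo a c, h x ≤ k) → IntervalIntegrable (fun x => w x * h x) volume 0 T →
      ∫ x in (0:ℝ)..T, w x * h x ≤ k * I := by
    intro k h hk hi
    rw [hI, ← intervalIntegral.integral_const_mul]
    apply intervalIntegral.integral_mono_on hT.le hi (iI.const_mul k)
    intro x _
    by_cases hx : x ∈ Ioo a c
    · nlinarith [hk x hx, hw0 x]
    · rw [hwz x hx]; simp
  have hmem : ∀ x ∈ Ioo a c, x ∈ Icc 0 b := fun x hx => ⟨ha.trans hx.1.le, hx.2.le.trans hcb⟩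
  have P1 : 1 / 4 * I ≤ P := hlow _ _ (fun x hx => by
    nlinarith [nφ x (hmem x hx), nf x (hmem x hx), (nφ x (hmem x hx)).1, (nf x (hmem x hx)).1]) iP
  have P2 : P ≤ 9 / 4 * I := hup _ _ (fun x hx => by
    have := mul_le_mul (nφ x (hmem x hx)).2 (nf x (hmem x hx)).2 (by linarith [(nf x (hmem x hx)).1]) (by norm_num)
    linarith) iP
  have Z1 : a ^ 2 / 4 * I ≤ Z := hlow _ _ (fun x hx => by
    have hxp : 0 ≤ x := ha.trans hx.1.le
    have := mul_le_mul (nχ x (hmem x hx)).1 (ng x (hmem x hx)).1 (by linarith) (by linarith [(nχ x (hmem x hx)).1])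
    nlinarith [hx.1]) iZ
  have Z2 : Z ≤ 9 / 4 * c ^ 2 * I := hup _ _ (fun x hx => by
    have hxp : 0 ≤ x := ha.trans hx.1.le
    have := mul_le_mul (nχ x (hmem x hx)).2 (ng x (hmem x hx)).2 (by linarith [(ng x (hmem x hx)).1]) (by linarith)
    nlinarith [hx.2]) iZ
  refine ⟨P, Z, ?_, ?_, by linarith, by nlinarith [sq_nonneg a], by nlinarith [sq_nonneg c]⟩
  · rw [Matrix.adjugate_fin_two, Matrix.mul_apply, Fin.sum_univ_two]
    simp
    rw [← a1.1, ← a1.2, ← b1.1, ← b1.2]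
    linarith
  · rw [Matrix.adjugate_fin_two, Matrix.mul_apply, Fin.sum_univ_two]
    simp
    rw [← a2.1, ← a2.2, ← b2.1, ← b2.2]
    linarith

/-- Two small letters with noncommuting transfer matrices. -/
lemma exists_noncomm {T : ℝ} (hT : 0 < T) {q : ℝ → ℝ} (hq : Continuous q) {ε : ℝ} (hε : 0 < ε) :
    ∃ w : Bool → ℝ → ℝ, (∀ b, Continuous (w b)) ∧ (∀ b x, |w b x| ≤ ε) ∧
      (∀ b x, x ∉ Ioo 0 T → w b x = 0) ∧
      TM T (fun x => q x + w true x) * TM T (fun x => q x + w false x) ≠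
        TM T (fun x => q x + w false x) * TM T (fun x => q x + w true x) := by
  obtain ⟨K₀, hK₀⟩ := (isCompact_Icc (a := (0:ℝ)) (b := T)).exists_bound_of_continuousOn hq.continuousOn
  set K := max K₀ 1 + ε with hKdef
  have hK1 : 1 ≤ K := by linarith [le_max_right K₀ 1]
  have hK : ∀ x ∈ Icc 0 T, |q x| ≤ K := fun x hx => by
    have := hK₀ x hx
    rw [Real.norm_eq_abs] at this
    linarith [le_max_left K₀ 1]
  have hKs : ∀ w : ℝ → ℝ, (∀ x, |w x| ≤ ε) → ∀ x ∈ Icc 0 T, |q x + w x| ≤ K := fun w hw x hx => by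
    have := hK₀ x hx
    rw [Real.norm_eq_abs] at this
    linarith [le_max_left K₀ 1, abs_add_le (q x) (w x), hw x]
  set C := Real.exp (K * T) with hC
  have hC1 : 1 ≤ C := Real.one_le_exp (by positivity)
  have hKC : 0 < K * C := by positivity
  obtain ⟨b, hb0, hbT, hb⟩ : ∃ b, 0 < b ∧ b ≤ T ∧ K * C * b ≤ 1 / 2 := by
    refine ⟨min T (1 / 2 / (K * C)), by positivity, min_le_left _ _, ?_⟩
    calc _ ≤ K * C * (1 / 2 / (K * C)) := by gcongr; exact min_le_right _ _
      _ = 1 / 2 := by field_simp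
  let bump : ℝ → ℝ → ℝ → ℝ := fun a c x => ε / b ^ 2 * max 0 ((x - a) * (c - x))
  have bc : ∀ a c, Continuous (bump a c) := fun a c => by unfold bump; fun_prop
  have b0 : ∀ a c x, 0 ≤ bump a c x := fun a c x => by unfold bump; positivity
  have bz : ∀ a c, a < c → ∀ x, x ∉ Ioo a c → bump a c x = 0 := by
    intro a c hac x hx
    simp only [bump]
    rw [max_eq_left, mul_zero]
    rw [mem_Ioo, not_and_or, not_lt, not_lt] at hx
    rcases hx with hx | hx
    · exact mul_nonpos_of_nonpos_of_nonneg (by linarith) (by linarith)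
    · exact mul_nonpos_of_nonneg_of_nonpos (by linarith) (by linarith)
  have bp : ∀ a c, ∀ x ∈ Ioo a c, 0 < bump a c x := by
    intro a c x hx
    have : 0 < (x - a) * (c - x) := mul_pos (by linarith [hx.1]) (by linarith [hx.2])
    simp only [bump]
    rw [max_eq_right this.le]
    positivity
  have be : ∀ a c, 0 ≤ a → a < c → c ≤ b → ∀ x, |bump a c x| ≤ ε := by
    intro a c ha hac hcb x
    rw [abs_of_nonneg (b0 a c x)]
    by_cases hx : x ∈ Ioo a c
    · simp only [bump]
      have : max 0 ((x - a) * (c - x)) ≤ b ^ 2 := by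
        apply max_le (by positivity)
        rw [sq]
        exact mul_le_mul (by linarith [hx.2]) (by linarith [hx.1]) (by linarith [hx.2]) hb0.le
      calc _ ≤ ε / b ^ 2 * b ^ 2 := by gcongr
        _ = ε := by field_simp
    · rw [bz a c hac x hx]; exact hε.le
  have l1 : b / 128 < b / 64 := by linarith
  have l2 : b / 2 < b := by linarith
  set w1 := bump (b / 128) (b / 64) with hw1
  set w2 := bump (b / 2) b with hw2
  have e1 := be (b / 128) (b / 64) (by linarith) l1 (by linarith)
  have e2 := be (b / 2) b (by linarith) l2 le_rfl
  obtain ⟨P1, Z1, p1, z1, hP1, hl1, hu1⟩ := bump_entries hT hK1 hbT hb hq (bc (b/128) (b/64)) hK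
    (hKs _ e1) (by linarith) l1 (by linarith) (b0 _ _) (bz _ _ l1) (bp _ _)
  obtain ⟨P2, Z2, p2, z2, hP2, hl2, hu2⟩ := bump_entries hT hK1 hbT hb hq (bc (b/2) b) hK
    (hKs _ e2) (by linarith) l2 le_rfl (b0 _ _) (bz _ _ l2) (bp _ _)
  have v1 : ∀ x, x ∉ Ioo 0 T → w1 x = 0 := fun x hx => bz _ _ l1 x (fun h => hx ⟨by linarith [h.1], by linarith [h.2]⟩)
  have v2 : ∀ x, x ∉ Ioo 0 T → w2 x = 0 := fun x hx => bz _ _ l2 x (fun h => hx ⟨by linarith [h.1], by linarith [h.2]⟩)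
  set X0 := TM T q with hX0
  set X1 := TM T (fun x => q x + w1 x) with hX1
  set X2 := TM T (fun x => q x + w2 x) with hX2
  have hX00 : TM T (fun x => q x + (fun _ => (0:ℝ)) x) = X0 := by simp [hX0]
  by_contra hcon
  push Not at hcon
  have c01 : X0 * X1 = X1 * X0 := by
    have := hcon (fun t => if t then (fun _ => 0) else w1) (by intro t; cases t; exact bc _ _; exact continuous_const)
      (by intro t x; cases t; exact e1 x; simp [hε.le]) (by intro t x hx; cases t; exact v1 x hx; rfl)
    simpa using this
  have c02 : X0 * X2 = X2 * X0 := by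
    have := hcon (fun t => if t then (fun _ => 0) else w2) (by intro t; cases t; exact bc _ _; exact continuous_const)
      (by intro t x; cases t; exact e2 x; simp [hε.le]) (by intro t x hx; cases t; exact v2 x hx; rfl)
    simpa using this
  have c12 : X1 * X2 = X2 * X1 := by
    have := hcon (fun t => if t then w1 else w2) (by intro t; cases t; exact bc _ _; exact bc _ _)
      (by intro t x; cases t; exact e2 x; exact e1 x) (by intro t x hx; cases t; exact v2 x hx; exact v1 x hx)
    simpa using this
  have d0 : X0.det = 1 := TM_det hT hq
  have A1 : X0.adjugate * X0 = 1 := by rw [Matrix.adjugate_mul, d0, one_smul]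
  have A2 : X0 * X0.adjugate = 1 := by rw [Matrix.mul_adjugate, d0, one_smul]
  set Y := X0.adjugate with hY
  have cY : ∀ X, X0 * X = X * X0 → Y * X = X * Y := by
    intro X h
    calc Y * X = Y * X * (X0 * Y) := by rw [A2, mul_one]
      _ = Y * (X * X0) * Y := by simp only [mul_assoc]
      _ = Y * (X0 * X) * Y := by rw [h]
      _ = (Y * X0) * X * Y := by simp only [mul_assoc]
      _ = X * Y := by rw [A1, one_mul]
  have cN : (Y * X1) * (Y * X2) = (Y * X2) * (Y * X1) := by
    calc (Y * X1) * (Y * X2) = Y * (X1 * Y) * X2 := by simp only [mul_assoc]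
      _ = Y * Y * (X1 * X2) := by rw [← cY X1 c01]; simp only [mul_assoc]
      _ = Y * (Y * X2) * X1 := by rw [c12]; simp only [mul_assoc]
      _ = Y * (X2 * Y) * X1 := by rw [cY X2 c02]
      _ = _ := by simp only [mul_assoc]
  have h00 := congrFun (congrFun cN 0) 0
  rw [Matrix.mul_apply, Matrix.mul_apply, Fin.sum_univ_two, Fin.sum_univ_two, p1, p2, z1, z2] at h00
  have hZP : Z1 * P2 = Z2 * P1 := by linarith
  have hPP : 0 < P1 * P2 := mul_pos hP1 hP2
  have f1 : (b / 2) ^ 2 * P2 * P1 ≤ 9 * Z2 * P1 := by gcongr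
  have f2 : Z1 * P2 ≤ 9 * (b / 64) ^ 2 * P1 * P2 := by gcongr
  nlinarith [mul_pos (pow_pos hb0 2) hPP]


/-! ### Part E: finitely many hyperbolic walls -/

lemma TM_continuous {T : ℝ} (hT : 0 < T) {V : ℝ → ℝ} (hV : Continuous V) :
    Continuous (fun p : ℝ × ℝ => TM T (fun x => p.2 * V x - p.1)) := by
  rw [continuous_iff_continuousAt]
  intro p₀
  obtain ⟨Q₀, hQ₀⟩ := (isCompact_Icc (a := (0:ℝ)) (b := T)).exists_bound_of_continuousOn hV.continuousOn
  set Q := max Q₀ 1 with hQdef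
  have hQ1 : 1 ≤ Q := le_max_right _ _
  have hQ : ∀ x ∈ Icc 0 T, |V x| ≤ Q := fun x hx => (hQ₀ x hx).trans (le_max_left _ _)
  set K := (|p₀.2| + 1) * Q + |p₀.1| + 1 with hKdef
  have hK1 : 1 ≤ K := by
    have : 0 ≤ (|p₀.2| + 1) * Q := by positivity
    linarith [abs_nonneg p₀.1]
  have hKb : ∀ p ∈ Metric.ball p₀ 1, ∀ x ∈ Icc 0 T, |p.2 * V x - p.1| ≤ K := by
    intro p hp x hx
    rw [Metric.mem_ball, Prod.dist_eq, max_lt_iff, Real.dist_eq, Real.dist_eq] at hp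
    have h1 : |p.1| ≤ |p₀.1| + 1 := by
      have := abs_sub_abs_le_abs_sub p.1 p₀.1; linarith [hp.1]
    have h2 : |p.2| ≤ |p₀.2| + 1 := by
      have := abs_sub_abs_le_abs_sub p.2 p₀.2; linarith [hp.2]
    calc _ ≤ |p.2 * V x| + |p.1| := abs_sub _ _
      _ = |p.2| * |V x| + |p.1| := by rw [abs_mul]
      _ ≤ (|p₀.2| + 1) * Q + (|p₀.1| + 1) := by
        gcongr; exact hQ x hx
      _ = K := by rw [hKdef]; ring
  have hp₀ : p₀ ∈ Metric.ball p₀ 1 := Metric.mem_ball_self one_pos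
  refine tendsto_pi_nhds.2 fun i => tendsto_pi_nhds.2 fun j => ?_
  rw [tendsto_iff_dist_tendsto_zero]
  have hlim : Tendsto (fun p : ℝ × ℝ => 2 * Real.exp (K * T) ^ 3 * T * (|p.2 - p₀.2| * Q + |p.1 - p₀.1|))
      (nhds p₀) (nhds 0) := by
    have : Continuous (fun p : ℝ × ℝ => 2 * Real.exp (K * T) ^ 3 * T * (|p.2 - p₀.2| * Q + |p.1 - p₀.1|)) := by
      fun_prop
    have h := this.tendsto p₀
    simpa using h
  refine squeeze_zero' (Eventually.of_forall fun p => dist_nonneg) ?_ hlim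
  filter_upwards [Metric.ball_mem_nhds p₀ one_pos] with p hp
  rw [Real.dist_eq]
  refine TM_lip hT (by fun_prop) (by fun_prop) hK1 (hKb p₀ hp₀) (hKb p hp) ?_ i j
  intro x hx
  have : p.2 * V x - p.1 - (p₀.2 * V x - p₀.1) = (p.2 - p₀.2) * V x - (p.1 - p₀.1) := by ring
  rw [this]
  refine (abs_sub _ _).trans ?_
  rw [abs_mul]
  gcongr
  exact hQ x hx

lemma prodM_continuous {f : ℝ × ℝ → ℕ → Matrix (Fin 2) (Fin 2) ℝ} (hf : ∀ j, Continuous (fun p => f p j))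
    (n : ℕ) : Continuous (fun p => prodM (f p) n) := by
  induction n with
  | zero => exact continuous_const
  | succ n ih => exact (hf n).mul ih

/-- A finite block of letters, repeated periodically. -/
def GoodWall (T ε : ℝ) (w : ℕ × (ℕ → ℝ → ℝ)) : Prop :=
  0 < w.1 ∧ (∀ j, Continuous (w.2 j)) ∧ (∀ j x, |w.2 j x| ≤ ε) ∧
    (∀ j x, x ∉ Ioo 0 T → w.2 j x = 0) ∧ ∀ j, w.2 (j + w.1) = w.2 j

/-- the word trace -/
def wallTrace (T : ℝ) (V : ℝ → ℝ) (w : ℕ × (ℕ → ℝ → ℝ)) (p : ℝ × ℝ) : ℝ :=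
  (prodM (fun j => TM T (fun x => p.2 * (V x + w.2 j x) - p.1)) w.1).trace

lemma local_wall {T : ℝ} (hT : 0 < T) {V : ℝ → ℝ} (hV : Continuous V) {ε : ℝ} (hε : 0 < ε)
    (p₀ : ℝ × ℝ) (hp : 0 < p₀.2) :
    ∃ w, GoodWall T ε w ∧ ∃ τ : ℝ, 0 < τ ∧ ∀ᶠ p in nhds p₀, 2 + τ ≤ |wallTrace T V w p| := by
  obtain ⟨w, hwc, hwb, hwz, hne⟩ := exists_noncomm hT (q := fun x => p₀.2 * V x - p₀.1) (by fun_prop)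
    (ε := ε * p₀.2) (by positivity)
  set F : Bool → Matrix (Fin 2) (Fin 2) ℝ := fun b => TM T (fun x => p₀.2 * V x - p₀.1 + w b x) with hF
  obtain ⟨n, c, hn, htr⟩ := sl_word_fun F (fun b => TM_det hT (by have := hwc b; fun_prop)) hne
  set W : ℕ × (ℕ → ℝ → ℝ) := (n, fun j x => (p₀.2)⁻¹ * w (c (j % n)) x) with hW
  have hcont : Continuous (fun p => |wallTrace T V W p|) := by
    unfold wallTrace
    refine (Continuous.matrix_trace ?_).abs
    apply prodM_continuous
    intro j
    apply TM_continuous hT (V := fun x => V x + W.2 j x)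
    have := hwc (c (j % n))
    simp only [hW]
    fun_prop
  have h0 : 2 < |wallTrace T V W p₀| := by
    convert htr using 3
    unfold wallTrace
    rw [prodM_congr]
    intro j hj
    have hj' : j % n = j := Nat.mod_eq_of_lt hj
    simp only [hW, hF, hj']
    congr 1
    ext x
    field_simp
    ring
  refine ⟨W, ⟨hn, ?_, ?_, ?_, ?_⟩, (|wallTrace T V W p₀| - 2) / 2, by linarith, ?_⟩
  · intro j
    have := hwc (c (j % n))
    simp only [hW]
    fun_prop
  · intro j x
    simp only [hW, abs_mul, abs_inv, abs_of_pos hp]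
    calc _ ≤ p₀.2⁻¹ * (ε * p₀.2) := by gcongr; exact hwb _ _
      _ = ε := by field_simp
  · intro j x hx
    simp only [hW, hwz _ x hx, mul_zero]
  · intro j
    simp only [hW, Nat.add_mod_right]
  · have := (hcont.tendsto p₀).eventually (lt_mem_nhds (a := 2 + (|wallTrace T V W p₀| - 2) / 2) (by linarith))
    filter_upwards [this] with p hp using hp.le

lemma global_walls {T : ℝ} (hT : 0 < T) {V : ℝ → ℝ} (hV : Continuous V) {ε : ℝ} (hε : 0 < ε)
    {s : Set (ℝ × ℝ)} (hs : IsCompact s) (hpos : ∀ p ∈ s, 0 < p.2) :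
    ∃ l : List (ℕ × (ℕ → ℝ → ℝ)), (∀ w ∈ l, GoodWall T ε w) ∧ ∃ τ : ℝ, 0 < τ ∧
      ∀ p ∈ s, ∃ w ∈ l, 2 + τ ≤ |wallTrace T V w p| := by
  suffices h : ∃ l : List (ℕ × (ℕ → ℝ → ℝ)), (∀ w ∈ l, GoodWall T ε w) ∧ ∃ τ : ℝ, 0 < τ ∧
      ∀ p ∈ s, 0 < p.2 → ∃ w ∈ l, 2 + τ ≤ |wallTrace T V w p| by
    obtain ⟨l, h1, τ, h2, h3⟩ := h
    exact ⟨l, h1, τ, h2, fun p hp => h3 p hp (hpos p hp)⟩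
  refine hs.induction_on (p := fun s => ∃ l : List (ℕ × (ℕ → ℝ → ℝ)),
      (∀ w ∈ l, GoodWall T ε w) ∧ ∃ τ : ℝ, 0 < τ ∧
      ∀ p ∈ s, 0 < p.2 → ∃ w ∈ l, 2 + τ ≤ |wallTrace T V w p|) ?_ ?_ ?_ ?_
  · exact ⟨[], by simp, 1, one_pos, by simp⟩
  · rintro a b hab ⟨l, h1, τ, h2, h3⟩
    exact ⟨l, h1, τ, h2, fun p hp => h3 p (hab hp)⟩
  · rintro a b ⟨l, h1, τ, h2, h3⟩ ⟨l', h1', τ', h2', h3'⟩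
    refine ⟨l ++ l', ?_, min τ τ', lt_min h2 h2', ?_⟩
    · intro w hw
      rcases List.mem_append.1 hw with h | h
      · exact h1 w h
      · exact h1' w h
    · rintro p (hp | hp) hp0
      · obtain ⟨w, hw, h⟩ := h3 p hp hp0
        exact ⟨w, List.mem_append_left _ hw, by linarith [min_le_left τ τ']⟩
      · obtain ⟨w, hw, h⟩ := h3' p hp hp0
        exact ⟨w, List.mem_append_right _ hw, by linarith [min_le_right τ τ']⟩
  · intro p hp
    obtain ⟨w, hw, τ, hτ, h⟩ := local_wall hT hV hε p (hpos p hp)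
    refine ⟨_, mem_nhdsWithin_of_mem_nhds h, [w], by simpa using hw, τ, hτ, ?_⟩
    intro p' hp' _
    exact ⟨w, by simp, hp'⟩


/-! ### Part F: decay inside a wall -/

lemma mulVec_bound {M : Matrix (Fin 2) (Fin 2) ℝ} {B : ℝ} (hM : ∀ i k, |M i k| ≤ B)
    (v : Fin 2 → ℝ) : ‖Matrix.mulVec M v‖ ≤ 2 * B * ‖v‖ := by
  have hB : 0 ≤ B := (abs_nonneg _).trans (hM 0 0)
  rw [pi_norm_le_iff_of_nonneg (by positivity)]
  intro i
  rw [Matrix.mulVec, dotProduct, Fin.sum_univ_two, Real.norm_eq_abs]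
  have h0 : |v 0| ≤ ‖v‖ := norm_le_pi_norm v 0
  have h1 : |v 1| ≤ ‖v‖ := norm_le_pi_norm v 1
  calc _ ≤ |M i 0 * v 0| + |M i 1 * v 1| := abs_add_le _ _
    _ = |M i 0| * |v 0| + |M i 1| * |v 1| := by rw [abs_mul, abs_mul]
    _ ≤ B * ‖v‖ + B * ‖v‖ := by gcongr <;> apply hM
    _ = _ := by ring

lemma prodM_bound {f : ℕ → Matrix (Fin 2) (Fin 2) ℝ} {B : ℝ} (hf : ∀ j i k, |f j i k| ≤ B)
    (n : ℕ) (v : Fin 2 → ℝ) : ‖Matrix.mulVec (prodM f n) v‖ ≤ (2 * B) ^ n * ‖v‖ := by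
  have hB : 0 ≤ B := (abs_nonneg _).trans (hf 0 0 0)
  induction n with
  | zero => simp [prodM]
  | succ n ih =>
    rw [prodM, ← Matrix.mulVec_mulVec]
    calc _ ≤ 2 * B * ‖Matrix.mulVec (prodM f n) v‖ := mulVec_bound (hf n) _
      _ ≤ 2 * B * ((2 * B) ^ n * ‖v‖) := by gcongr
      _ = _ := by ring

lemma prodM_err {f : ℕ → Matrix (Fin 2) (Fin 2) ℝ} {B : ℝ} (hB : 1 ≤ B) (hf : ∀ j i k, |f j i k| ≤ B)
    {U : ℕ → Fin 2 → ℝ} {G : ℝ} (n : ℕ)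
    (hU : ∀ j < n, ‖U (j + 1) - Matrix.mulVec (f j) (U j)‖ ≤ G) :
    ‖U n - Matrix.mulVec (prodM f n) (U 0)‖ ≤ n * (2 * B) ^ n * G := by
  induction n with
  | zero => simp [prodM]
  | succ n ih =>
    have hG : 0 ≤ G := (norm_nonneg _).trans (hU 0 (Nat.succ_pos _))
    have ih' := ih (fun j hj => hU j (hj.trans (Nat.lt_succ_self n)))
    have h1 := hU n (Nat.lt_succ_self n)
    have e : U (n + 1) - Matrix.mulVec (prodM f (n + 1)) (U 0) =
        (U (n + 1) - Matrix.mulVec (f n) (U n)) +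
          Matrix.mulVec (f n) (U n - Matrix.mulVec (prodM f n) (U 0)) := by
      rw [prodM, ← Matrix.mulVec_mulVec, Matrix.mulVec_sub]
      abel
    rw [e]
    have hp : 1 ≤ (2 * B) ^ (n + 1) := one_le_pow₀ (by linarith)
    calc _ ≤ _ := norm_add_le _ _
      _ ≤ G + 2 * B * ‖U n - Matrix.mulVec (prodM f n) (U 0)‖ := add_le_add h1 (mulVec_bound (hf n) _)
      _ ≤ (2 * B) ^ (n + 1) * G + 2 * B * (n * (2 * B) ^ n * G) := by
        gcongr
        nlinarith
      _ = _ := by push_cast; ring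

lemma wall_decay {n : ℕ} {f : ℕ → Matrix (Fin 2) (Fin 2) ℝ} (hper : ∀ j, f (j + n) = f j)
    (hdet : ∀ j, (f j).det = 1) {B : ℝ} (hB : 1 ≤ B) (hf : ∀ j i k, |f j i k| ≤ B)
    {τ : ℝ} (hτ : 0 < τ) (htr : 2 + τ ≤ |(prodM f n).trace|) {U : ℕ → Fin 2 → ℝ} {G A : ℝ} {K : ℕ}
    (hG : 0 ≤ G) (hA : 0 ≤ A)
    (hU : ∀ j < 2 * K * n, ‖U (j + 1) - Matrix.mulVec (f j) (U j)‖ ≤ G)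
    (hUA : ∀ j ≤ 2 * K * n, ‖U j‖ ≤ A) :
    ‖U (K * n)‖ ≤ (2 / (2 + τ)) ^ K * A + K * ((2 + (2 * B) ^ n) * (n * (2 * B) ^ n)) * G := by
  set M := prodM f n with hM
  set t := M.trace with ht
  have hperl : ∀ l j, f (l * n + j) = f j := by
    intro l
    induction l with
    | zero => simp
    | succ l ih => intro j; rw [show (l + 1) * n + j = (l * n + j) + n by ring, hper, ih]
  have hb : 1 ≤ (2 * B) ^ n := one_le_pow₀ (by linarith)
  set g := n * (2 * B) ^ n * G with hg
  have hg0 : 0 ≤ g := by positivity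
  have hF : ∀ l < 2 * K, ‖U ((l + 1) * n) - Matrix.mulVec M (U (l * n))‖ ≤ g := by
    intro l hl
    have := prodM_err (f := f) hB hf (U := fun j => U (l * n + j)) (G := G) n (by
      intro j hj
      have h2 := hU (l * n + j) (by
        calc l * n + j < l * n + n := by omega
          _ = (l + 1) * n := by ring
          _ ≤ 2 * K * n := Nat.mul_le_mul_right _ hl)
      rwa [hperl] at h2)
    rw [show (l + 1) * n = l * n + n by ring]
    simpa using this
  have htp : 2 < |t| := by linarith
  have hdetM : M.det = 1 := prodM_det hdet n
  have hch := sl_ch M hdetM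
  have step : ∀ l, l + 1 < 2 * K → ‖U ((l + 1) * n)‖ ≤
      1 / (2 + τ) * (‖U ((l + 2) * n)‖ + ‖U (l * n)‖) + (2 + (2 * B) ^ n) * g := by
    intro l hl
    have h1 := hF l (by omega)
    have h2 := hF (l + 1) hl
    rw [show l + 1 + 1 = l + 2 by ring] at h2
    set x0 := U (l * n)
    set x1 := U ((l + 1) * n)
    set x2 := U ((l + 2) * n)
    have e : t • x1 = x2 + x0 - (x2 - Matrix.mulVec M x1) - Matrix.mulVec M (x1 - Matrix.mulVec M x0)
        + t • (x1 - Matrix.mulVec M x0) := by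
      have : Matrix.mulVec M (Matrix.mulVec M x0) = t • Matrix.mulVec M x0 - x0 := by
        rw [Matrix.mulVec_mulVec, hch, Matrix.sub_mulVec, Matrix.smul_mulVec, Matrix.one_mulVec]
      rw [Matrix.mulVec_sub, this, smul_sub]
      abel
    have hn : |t| * ‖x1‖ ≤ ‖x2‖ + ‖x0‖ + g + (2 * B) ^ n * g + |t| * g := by
      rw [← Real.norm_eq_abs, ← norm_smul, e]
      have k1 := norm_add_le (x2 + x0 - (x2 - Matrix.mulVec M x1) - Matrix.mulVec M (x1 - Matrix.mulVec M x0))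
        (t • (x1 - Matrix.mulVec M x0))
      have k2 := norm_sub_le (x2 + x0 - (x2 - Matrix.mulVec M x1)) (Matrix.mulVec M (x1 - Matrix.mulVec M x0))
      have k3 := norm_sub_le (x2 + x0) (x2 - Matrix.mulVec M x1)
      have k4 := norm_add_le x2 x0
      have k5 : ‖Matrix.mulVec M (x1 - Matrix.mulVec M x0)‖ ≤ (2 * B) ^ n * g :=
        (prodM_bound hf n _).trans (by gcongr)
      have k6 : ‖t • (x1 - Matrix.mulVec M x0)‖ ≤ ‖t‖ * g := by
        rw [norm_smul]; gcongr
      linarith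
    have htp0 : 0 < |t| := by linarith
    have h3 : ‖x1‖ ≤ (‖x2‖ + ‖x0‖ + g + (2 * B) ^ n * g + |t| * g) / |t| := by
      rw [le_div_iff₀ htp0]; linarith
    refine h3.trans ?_
    rw [show (‖x2‖ + ‖x0‖ + g + (2 * B) ^ n * g + |t| * g) / |t| =
      1 / |t| * (‖x2‖ + ‖x0‖) + (1 / |t| * ((1 + (2 * B) ^ n) * g) + g) by field_simp; ring]
    have h4 : 1 / |t| ≤ 1 / (2 + τ) := one_div_le_one_div_of_le (by linarith) htr
    have h5 : 1 / |t| ≤ 1 := by rw [div_le_one htp0]; linarith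
    have h6 : 1 / |t| * ((1 + (2 * B) ^ n) * g) ≤ 1 * ((1 + (2 * B) ^ n) * g) := by gcongr
    have h7 : 1 / |t| * (‖x2‖ + ‖x0‖) ≤ 1 / (2 + τ) * (‖x2‖ + ‖x0‖) := by gcongr
    linarith
  have main : ∀ j ≤ K, ∀ l, j ≤ l → l + j ≤ 2 * K →
      ‖U (l * n)‖ ≤ (2 / (2 + τ)) ^ j * A + j * ((2 + (2 * B) ^ n) * g) := by
    intro j
    induction j with
    | zero =>
      intro _ l _ hl
      have := hUA (l * n) (Nat.mul_le_mul_right _ (by omega))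
      simpa using this
    | succ j ih =>
      intro hj l hl1 hl2
      obtain ⟨l, rfl⟩ : ∃ l', l = l' + 1 := ⟨l - 1, by omega⟩
      have s := step l (by omega)
      have i1 := ih (by omega) (l + 2) (by omega) (by omega)
      have i2 := ih (by omega) l (by omega) (by omega)
      set P := (2 / (2 + τ)) ^ j * A
      set Q := (2 + (2 * B) ^ n) * g
      have hQ : 0 ≤ Q := by positivity
      have hr : 2 / (2 + τ) ≤ 1 := by rw [div_le_one (by linarith)]; linarith
      calc _ ≤ 1 / (2 + τ) * ((P + j * Q) + (P + j * Q)) + Q := by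
            refine s.trans ?_
            gcongr
        _ = 2 / (2 + τ) * P + 2 / (2 + τ) * (j * Q) + Q := by ring
        _ ≤ 2 / (2 + τ) * P + 1 * (j * Q) + Q := by gcongr
        _ = _ := by push_cast; simp only [P, Q]; ring
  have := main K le_rfl K le_rfl (by omega)
  refine this.trans (le_of_eq ?_)
  rw [hg]; ring


/-! ### Part G: Cauchy-Schwarz and a Sobolev estimate -/

lemma interval_cs {a b : ℝ} (hab : a ≤ b) {g h : ℝ → ℝ} (hg : ContinuousOn g (Icc a b))
    (hh : ContinuousOn h (Icc a b)) :
    (∫ x in a..b, g x * h x) ^ 2 ≤ (∫ x in a..b, g x ^ 2) * ∫ x in a..b, h x ^ 2 := by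
  rw [← uIcc_of_le hab] at hg hh
  have ig : IntervalIntegrable (fun x => g x ^ 2) volume a b := (hg.pow 2).intervalIntegrable
  have ih : IntervalIntegrable (fun x => h x ^ 2) volume a b := (hh.pow 2).intervalIntegrable
  have igh : IntervalIntegrable (fun x => g x * h x) volume a b := (hg.mul hh).intervalIntegrable
  have key : ∀ t : ℝ, 0 ≤ (∫ x in a..b, h x ^ 2) * (t * t) + (2 * ∫ x in a..b, g x * h x) * t +
      ∫ x in a..b, g x ^ 2 := by
    intro t
    have e : (∫ x in a..b, (g x + t * h x) ^ 2) = (∫ x in a..b, h x ^ 2) * (t * t) +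
        (2 * ∫ x in a..b, g x * h x) * t + ∫ x in a..b, g x ^ 2 := by
      have : ∀ x, (g x + t * h x) ^ 2 = (t * t) * h x ^ 2 + (2 * t) * (g x * h x) + g x ^ 2 := fun x => by ring
      simp only [this]
      rw [intervalIntegral.integral_add ((ih.const_mul _).add (igh.const_mul _)) ig,
        intervalIntegral.integral_add (ih.const_mul _) (igh.const_mul _),
        intervalIntegral.integral_const_mul, intervalIntegral.integral_const_mul]
      ring
    rw [← e]
    exact intervalIntegral.integral_nonneg hab (fun x _ => sq_nonneg _)
  have := discrim_le_zero key
  rw [discrim] at this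
  nlinarith

lemma interval_cs_one {a b : ℝ} (hab : a ≤ b) {g : ℝ → ℝ} (hg : ContinuousOn g (Icc a b)) :
    (∫ x in a..b, g x) ^ 2 ≤ (b - a) * ∫ x in a..b, g x ^ 2 := by
  have := interval_cs hab (g := fun _ => 1) continuousOn_const hg
  simpa using this

lemma sobolev_aux {T : ℝ} (hT : 0 < T) {ζ ζ1 ζ2 : ℝ → ℝ} (hζ : C2on T ζ ζ1 ζ2)
    (h0 : ζ T = 0) (h1 : ζ1 T = 0) : ∃ C : ℝ, 0 ≤ C ∧ ∀ u u1 u2, C2on T u u1 u2 →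
      (u 0 * ζ1 0 - u1 0 * ζ 0) ^ 2 ≤ C * ∫ x in (0:ℝ)..T, (u x ^ 2 + u2 x ^ 2) := by
  obtain ⟨A, hA⟩ := isCompact_Icc.exists_bound_of_continuousOn hζ.cu
  obtain ⟨B, hB⟩ := isCompact_Icc.exists_bound_of_continuousOn hζ.cu2
  refine ⟨T * (2 * (A ^ 2 + B ^ 2)), by positivity, ?_⟩
  intro u u1 u2 hu
  have hw := wronskian_ftc hT hu hζ le_rfl hT.le le_rfl
  rw [h0, h1] at hw
  have e : (u 0 * ζ1 0 - u1 0 * ζ 0) = -∫ x in (0:ℝ)..T, (u x * ζ2 x - u2 x * ζ x) := by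
    rw [hw]; ring
  have c1 : ContinuousOn (fun x => u x * ζ2 x - u2 x * ζ x) (Icc 0 T) :=
    (hu.cu.mul hζ.cu2).sub (hu.cu2.mul hζ.cu)
  rw [e, neg_sq]
  refine (interval_cs_one hT.le c1).trans ?_
  rw [sub_zero, mul_assoc]
  refine mul_le_mul_of_nonneg_left ?_ hT.le
  rw [← intervalIntegral.integral_const_mul]
  apply intervalIntegral.integral_mono_on hT.le
  · apply ContinuousOn.intervalIntegrable
    rw [uIcc_of_le hT.le]
    exact c1.pow 2
  · apply ContinuousOn.intervalIntegrable
    rw [uIcc_of_le hT.le]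
    exact continuousOn_const.mul ((hu.cu.pow 2).add (hu.cu2.pow 2))
  · intro x hx
    have a1 := hA x hx
    have b1 := hB x hx
    rw [Real.norm_eq_abs] at a1 b1
    have a2 : ζ x ^ 2 ≤ A ^ 2 := sq_le_sq' (by linarith [(abs_le.1 a1).1]) (abs_le.1 a1).2
    have b2 : ζ2 x ^ 2 ≤ B ^ 2 := sq_le_sq' (by linarith [(abs_le.1 b1).1]) (abs_le.1 b1).2
    have k1 : (u x * ζ2 x - u2 x * ζ x) ^ 2 ≤ 2 * (u x ^ 2 * ζ2 x ^ 2 + u2 x ^ 2 * ζ x ^ 2) := by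
      nlinarith [sq_nonneg (u x * ζ2 x + u2 x * ζ x)]
    have k2 : u x ^ 2 * ζ2 x ^ 2 ≤ u x ^ 2 * B ^ 2 := by gcongr
    have k3 : u2 x ^ 2 * ζ x ^ 2 ≤ u2 x ^ 2 * A ^ 2 := by gcongr
    nlinarith [sq_nonneg (u x * A), sq_nonneg (u2 x * B)]

/-- Sobolev estimate at the left endpoint. -/
lemma sobolev {T : ℝ} (hT : 0 < T) : ∃ C : ℝ, 0 ≤ C ∧ ∀ u u1 u2, C2on T u u1 u2 →
    u 0 ^ 2 ≤ C * ∫ x in (0:ℝ)..T, (u x ^ 2 + u2 x ^ 2) ∧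
    u1 0 ^ 2 ≤ C * ∫ x in (0:ℝ)..T, (u x ^ 2 + u2 x ^ 2) := by
  obtain ⟨C1, hC1, h1⟩ := sobolev_aux hT (ζ := fun x => x * (T - x) ^ 2)
    (ζ1 := fun x => (T - x) ^ 2 - 2 * x * (T - x)) (ζ2 := fun x => 6 * x - 4 * T)
    ⟨by fun_prop, by fun_prop, by fun_prop, fun x _ => by
      have := (hasDerivAt_id x).mul (((hasDerivAt_id x).const_sub T).pow 2)
      convert! this using 1
      simp; ring, fun x _ => by
      have := (((hasDerivAt_id x).const_sub T).pow 2).sub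
        (((hasDerivAt_id x).const_mul 2).mul ((hasDerivAt_id x).const_sub T))
      convert! this using 1
      simp; ring⟩ (by simp) (by simp)
  obtain ⟨C2, hC2, h2⟩ := sobolev_aux hT (ζ := fun x => (T - x) ^ 2 * (T + 2 * x))
    (ζ1 := fun x => - (6 * x * (T - x))) (ζ2 := fun x => 12 * x - 6 * T)
    ⟨by fun_prop, by fun_prop, by fun_prop, fun x _ => by
      have := (((hasDerivAt_id x).const_sub T).pow 2).mul (((hasDerivAt_id x).const_mul 2).const_add T)
      convert! this using 1
      simp; ring, fun x _ => by
      have := (((hasDerivAt_id x).const_mul 6).mul ((hasDerivAt_id x).const_sub T)).neg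
      convert! this using 1
      simp; ring⟩ (by simp) (by simp)
  refine ⟨C1 / T ^ 4 + C2 / T ^ 6, by positivity, ?_⟩
  intro u u1 u2 hu
  have k1 := h1 u u1 u2 hu
  have k2 := h2 u u1 u2 hu
  set I := ∫ x in (0:ℝ)..T, (u x ^ 2 + u2 x ^ 2) with hI
  have hI0 : 0 ≤ I := intervalIntegral.integral_nonneg hT.le (fun x _ => by positivity)
  simp only [sub_zero, mul_zero, zero_mul, neg_zero, add_zero, zero_sub] at k1 k2
  constructor
  · have : u 0 ^ 2 ≤ C1 / T ^ 4 * I := by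
      rw [div_mul_eq_mul_div, le_div_iff₀ (by positivity)]
      nlinarith
    have : 0 ≤ C2 / T ^ 6 * I := by positivity
    linarith
  · have : u1 0 ^ 2 ≤ C2 / T ^ 6 * I := by
      rw [div_mul_eq_mul_div, le_div_iff₀ (by positivity)]
      nlinarith
    have : 0 ≤ C1 / T ^ 4 * I := by positivity
    linarith

/-- A `C²` function on the line with its derivatives. -/
structure C2R (u u1 u2 : ℝ → ℝ) : Prop where
  d1 : ∀ x, HasDerivAt u (u1 x) x
  d2 : ∀ x, HasDerivAt u1 (u2 x) x
  cu2 : Continuous u2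

lemma C2R.cu {u u1 u2 : ℝ → ℝ} (h : C2R u u1 u2) : Continuous u :=
  continuous_iff_continuousAt.2 fun x => (h.d1 x).continuousAt

lemma C2R.cu1 {u u1 u2 : ℝ → ℝ} (h : C2R u u1 u2) : Continuous u1 :=
  continuous_iff_continuousAt.2 fun x => (h.d2 x).continuousAt

lemma C2R.on {u u1 u2 : ℝ → ℝ} (h : C2R u u1 u2) (T : ℝ) : C2on T u u1 u2 :=
  ⟨h.cu.continuousOn, h.cu1.continuousOn, h.cu2.continuousOn, fun x _ => h.d1 x, fun x _ => h.d2 x⟩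

lemma C2R.shift {u u1 u2 : ℝ → ℝ} (h : C2R u u1 u2) (a c : ℝ) :
    C2R (fun x => c * u (a + x)) (fun x => c * u1 (a + x)) (fun x => c * u2 (a + x)) := by
  refine ⟨fun x => ?_, fun x => ?_, ?_⟩
  · have := ((h.d1 (a + x)).comp_const_add a x).const_mul c
    exact this
  · have := ((h.d2 (a + x)).comp_const_add a x).const_mul c
    exact this
  · have := h.cu2
    fun_prop


/-! ### Part J: counting -/

lemma poincare {a h : ℝ} (hh : 0 ≤ h) {v v1 : ℝ → ℝ} (hd : ∀ x, HasDerivAt v (v1 x) x)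
    (hc : Continuous v1) (ha : v a = 0) :
    ∫ x in a..(a + h), v x ^ 2 ≤ h ^ 2 * ∫ x in a..(a + h), v1 x ^ 2 := by
  have hv : Continuous v := continuous_iff_continuousAt.2 fun x => (hd x).continuousAt
  have hah : a ≤ a + h := by linarith
  set I := ∫ x in a..(a + h), v1 x ^ 2 with hI
  have hpt : ∀ x ∈ Icc a (a + h), v x ^ 2 ≤ h * I := by
    intro x hx
    have e : v x = ∫ y in a..x, v1 y := by
      rw [intervalIntegral.integral_eq_sub_of_hasDerivAt (fun y _ => hd y) (hc.intervalIntegrable _ _), ha, sub_zero]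
    rw [e]
    refine (interval_cs_one hx.1 hc.continuousOn).trans ?_
    have h2 : ∫ y in a..x, v1 y ^ 2 ≤ I := by
      apply intervalIntegral.integral_mono_interval le_rfl hx.1 hx.2
      · exact Eventually.of_forall fun y => sq_nonneg _
      · exact (hc.pow 2).intervalIntegrable _ _
    have h3 : 0 ≤ ∫ y in a..x, v1 y ^ 2 := intervalIntegral.integral_nonneg hx.1 (fun y _ => sq_nonneg _)
    exact mul_le_mul (by linarith [hx.2]) h2 h3 hh
  calc _ ≤ ∫ x in a..(a + h), h * I := by
        apply intervalIntegral.integral_mono_on hah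
        · exact (hv.pow 2).intervalIntegrable _ _
        · simp
        · exact hpt
    _ = h ^ 2 * I := by
      rw [intervalIntegral.integral_const, smul_eq_mul]; ring

lemma grid_bound {h : ℝ} (hh : 0 ≤ h) (n : ℕ) {v v1 v2 : ℝ → ℝ} (hv : C2R v v1 v2)
    (hz : ∀ k < n, v (k * h) = 0 ∧ v1 (k * h) = 0) :
    ∫ x in (0:ℝ)..(n * h), v x ^ 2 ≤ h ^ 4 * ∫ x in (0:ℝ)..(n * h), v2 x ^ 2 := by
  have e1 := intervalIntegral.sum_integral_adjacent_intervals (f := fun x => v x ^ 2) (μ := volume)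
    (a := fun k : ℕ => (k:ℝ) * h) (n := n) (fun k _ => (hv.cu.pow 2).intervalIntegrable _ _)
  have e2 := intervalIntegral.sum_integral_adjacent_intervals (f := fun x => v2 x ^ 2) (μ := volume)
    (a := fun k : ℕ => (k:ℝ) * h) (n := n) (fun k _ => (hv.cu2.pow 2).intervalIntegrable _ _)
  simp only [Nat.cast_zero, zero_mul] at e1 e2
  rw [← e1, ← e2, Finset.mul_sum]
  apply Finset.sum_le_sum
  intro k hk
  obtain ⟨z1, z2⟩ := hz k (Finset.mem_range.1 hk)
  have e : ((k + 1 : ℕ) : ℝ) * h = k * h + h := by push_cast; ring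
  rw [e]
  have p1 := poincare hh hv.d1 hv.cu1 z1
  have p2 := poincare hh hv.d2 hv.cu2 z2
  calc _ ≤ _ := p1
    _ ≤ h ^ 2 * (h ^ 2 * ∫ x in (k * h)..(k * h + h), v2 x ^ 2) := by gcongr
    _ = _ := by ring

/-- `E` is an approximate eigenvalue on `[0,L]` with small boundary data. -/
def Approx (L δ : ℝ) (q : ℝ → ℝ) (E : ℝ) : Prop :=
  ∃ v v1 v2 : ℝ → ℝ, C2R v v1 v2 ∧ (∫ x in (0:ℝ)..L, v x ^ 2) = 1 ∧ |v 0| ≤ δ ∧ |v1 0| ≤ δ ∧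
    |v L| ≤ δ ∧ |v1 L| ≤ δ ∧ (∫ x in (0:ℝ)..L, (v2 x - (q x - E) * v x) ^ 2) ≤ δ ^ 2

lemma near_orth {L δ : ℝ} (hL : 0 < L) (hδ : 0 < δ) (hδ1 : δ ≤ 1) {q : ℝ → ℝ} (hq : Continuous q)
    {E E' : ℝ} {v v1 v2 w w1 w2 : ℝ → ℝ} (hv : C2R v v1 v2) (hw : C2R w w1 w2)
    (nv : (∫ x in (0:ℝ)..L, v x ^ 2) = 1) (nw : (∫ x in (0:ℝ)..L, w x ^ 2) = 1)
    (v0 : |v 0| ≤ δ) (v10 : |v1 0| ≤ δ) (vL : |v L| ≤ δ) (v1L : |v1 L| ≤ δ)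
    (w0 : |w 0| ≤ δ) (w10 : |w1 0| ≤ δ) (wL : |w L| ≤ δ) (w1L : |w1 L| ≤ δ)
    (fv : (∫ x in (0:ℝ)..L, (v2 x - (q x - E) * v x) ^ 2) ≤ δ ^ 2)
    (fw : (∫ x in (0:ℝ)..L, (w2 x - (q x - E') * w x) ^ 2) ≤ δ ^ 2) :
    |E - E'| * |∫ x in (0:ℝ)..L, v x * w x| ≤ 6 * δ := by
  have cv := hv.cu
  have cv2 := hv.cu2
  have cw := hw.cu
  have cw2 := hw.cu2
  have hwr := wronskian_ftc hL (hv.on L) (hw.on L) le_rfl hL.le le_rfl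
  have e : ∀ x, v x * w2 x - v2 x * w x = (E - E') * (v x * w x) +
      (v x * (w2 x - (q x - E') * w x) - w x * (v2 x - (q x - E) * v x)) := fun x => by ring
  simp only [e] at hwr
  rw [intervalIntegral.integral_add (Continuous.intervalIntegrable (by fun_prop) _ _)
    (Continuous.intervalIntegrable (by fun_prop) _ _),
    intervalIntegral.integral_sub (Continuous.intervalIntegrable (by fun_prop) _ _)
    (Continuous.intervalIntegrable (by fun_prop) _ _), intervalIntegral.integral_const_mul] at hwr
  have c1 := interval_cs hL.le (g := v) (h := fun x => w2 x - (q x - E') * w x)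
    (by fun_prop) (by fun_prop)
  have c2 := interval_cs hL.le (g := w) (h := fun x => v2 x - (q x - E) * v x)
    (by fun_prop) (by fun_prop)
  rw [nv, one_mul] at c1
  rw [nw, one_mul] at c2
  have a1 := abs_le_of_sq_le_sq (c1.trans fw) hδ.le
  have a2 := abs_le_of_sq_le_sq (c2.trans fv) hδ.le
  have hp : ∀ a b : ℝ, |a| ≤ δ → |b| ≤ δ → |a * b| ≤ δ := fun a b ha hb => by
    rw [abs_mul]
    calc _ ≤ δ * 1 := mul_le_mul ha (hb.trans hδ1) (abs_nonneg _) hδ.le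
      _ = δ := mul_one _
  have p1 := hp _ _ vL w1L
  have p2 := hp _ _ v1L wL
  have p3 := hp _ _ v0 w10
  have p4 := hp _ _ v10 w0
  rw [← abs_mul]
  have a1' := abs_le.1 a1
  have a2' := abs_le.1 a2
  have p1' := abs_le.1 p1
  have p2' := abs_le.1 p2
  have p3' := abs_le.1 p3
  have p4' := abs_le.1 p4
  rw [abs_le]
  constructor
  · linarith [a1'.1, a1'.2, a2'.1, a2'.2, p1'.1, p1'.2, p2'.1, p2'.2, p3'.1, p3'.2, p4'.1, p4'.2]
  · linarith [a1'.1, a1'.2, a2'.1, a2'.2, p1'.1, p1'.2, p2'.1, p2'.2, p3'.1, p3'.2, p4'.1, p4'.2]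

lemma no_sep {L δ Q : ℝ} (hL : 0 < L) (hδ : 0 < δ) (hδ1 : δ ≤ 1) {q : ℝ → ℝ} (hq : Continuous q)
    {n m : ℕ} (hn : 0 < n) (hm : m = 2 * n + 1) (hsmall : 4 * (L / n) ^ 4 * m * (Q ^ 2 + 1) < 1)
    {ι : Type} [Fintype ι] (hι : Fintype.card ι = m) (E : ι → ℝ) (hE : ∀ i, Approx L δ q (E i))
    (hQ : ∀ i, ∀ x ∈ Icc 0 L, |q x - E i| ≤ Q)
    (hsep : ∀ i j, i ≠ j → 12 * m * δ ≤ |E i - E j|) : False := by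
  classical
  choose v v1 v2 hv nv v0 v10 vL v1L fv using hE
  have hmpos : (0:ℝ) < m := by rw [hm]; positivity
  set h := L / n with hh
  have hh0 : 0 < h := by positivity
  have hnh : n * h = L := by rw [hh]; field_simp
  -- near orthogonality
  have horth : ∀ i j, i ≠ j → |∫ x in (0:ℝ)..L, v i x * v j x| ≤ 1 / (2 * m) := by
    intro i j hij
    have h1 := near_orth hL hδ hδ1 hq (hv i) (hv j) (nv i) (nv j) (v0 i) (v10 i) (vL i) (v1L i)
      (v0 j) (v10 j) (vL j) (v1L j) (fv i) (fv j)
    have h2 := hsep i j hij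
    have h3 : 12 * m * δ * |∫ x in (0:ℝ)..L, v i x * v j x| ≤ 6 * δ :=
      (mul_le_mul_of_nonneg_right h2 (abs_nonneg _)).trans h1
    rw [le_div_iff₀ (by positivity)]
    by_contra hc
    push Not at hc
    nlinarith
  -- linear dependence
  let Φ : (ι → ℝ) →ₗ[ℝ] (Fin n ⊕ Fin n → ℝ) :=
    { toFun := fun c => Sum.elim (fun k => ∑ i, c i * v i (k * h)) (fun k => ∑ i, c i * v1 i (k * h))
      map_add' := by
        intro c d
        ext k
        rcases k with k | k <;> simp [add_mul, Finset.sum_add_distrib]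
      map_smul' := by
        intro a c
        ext k
        rcases k with k | k <;> simp [mul_assoc, Finset.mul_sum] }
  have hker : LinearMap.ker Φ ≠ ⊥ := by
    apply LinearMap.ker_ne_bot_of_finrank_lt
    simp [hι, hm]
    omega
  obtain ⟨c, hc, hc0⟩ := (Submodule.ne_bot_iff _).1 hker
  have hcz : ∀ k : Fin n, (∑ i, c i * v i (k * h)) = 0 ∧ (∑ i, c i * v1 i (k * h)) = 0 := by
    intro k
    exact ⟨congrFun (LinearMap.mem_ker.1 hc) (Sum.inl k), congrFun (LinearMap.mem_ker.1 hc) (Sum.inr k)⟩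
  set S := ∑ i, c i ^ 2 with hS
  have hSpos : 0 < S := by
    obtain ⟨i, hi⟩ := Function.ne_iff.1 hc0
    refine Finset.sum_pos' (fun i _ => sq_nonneg _) ⟨i, Finset.mem_univ _, ?_⟩
    have : c i ≠ 0 := hi
    positivity
  have hw : C2R (fun x => ∑ i, c i * v i x) (fun x => ∑ i, c i * v1 i x) (fun x => ∑ i, c i * v2 i x) := by
    refine ⟨fun x => ?_, fun x => ?_, ?_⟩
    · exact HasDerivAt.fun_sum fun i _ => ((hv i).d1 x).const_mul (c i)
    · exact HasDerivAt.fun_sum fun i _ => ((hv i).d2 x).const_mul (c i)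
    · exact continuous_finsetSum _ fun i _ => ((hv i).cu2).const_mul (c i)
  have hgrid := grid_bound hh0.le n hw (fun k hk => hcz ⟨k, hk⟩)
  rw [hnh] at hgrid
  -- upper bound for second derivatives
  have hup1 : ∀ i, ∫ x in (0:ℝ)..L, v2 i x ^ 2 ≤ 2 * (Q ^ 2 + 1) := by
    intro i
    have cv := (hv i).cu
    have cv2 := (hv i).cu2
    calc ∫ x in (0:ℝ)..L, v2 i x ^ 2 ≤ ∫ x in (0:ℝ)..L, (2 * Q ^ 2 * v i x ^ 2 + 2 * (v2 i x - (q x - E i) * v i x) ^ 2) := by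
          apply intervalIntegral.integral_mono_on hL.le
          · exact Continuous.intervalIntegrable (by fun_prop) _ _
          · exact Continuous.intervalIntegrable (by fun_prop) _ _
          · intro x hx
            have hq2 : (q x - E i) ^ 2 ≤ Q ^ 2 := by
              have := abs_le.1 (hQ i x hx)
              exact sq_le_sq' (by linarith [this.1]) this.2
            have k2 : (q x - E i) ^ 2 * v i x ^ 2 ≤ Q ^ 2 * v i x ^ 2 := by gcongr
            nlinarith [sq_nonneg ((v2 i x - (q x - E i) * v i x) - (q x - E i) * v i x)]
      _ = 2 * Q ^ 2 * 1 + 2 * ∫ x in (0:ℝ)..L, (v2 i x - (q x - E i) * v i x) ^ 2 := by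
          rw [intervalIntegral.integral_add (Continuous.intervalIntegrable (by fun_prop) _ _)
            (Continuous.intervalIntegrable (by fun_prop) _ _), intervalIntegral.integral_const_mul,
            intervalIntegral.integral_const_mul, nv i]
      _ ≤ 2 * Q ^ 2 * 1 + 2 * δ ^ 2 := by gcongr; exact fv i
      _ ≤ _ := by nlinarith
  have hup : ∫ x in (0:ℝ)..L, (∑ i, c i * v2 i x) ^ 2 ≤ S * (m * (2 * (Q ^ 2 + 1))) := by
    calc _ ≤ ∫ x in (0:ℝ)..L, S * ∑ i, v2 i x ^ 2 := by
          apply intervalIntegral.integral_mono_on hL.le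
          · exact Continuous.intervalIntegrable (hw.cu2.pow 2) _ _
          · exact Continuous.intervalIntegrable (continuous_const.mul (continuous_finsetSum _ fun i _ => ((hv i).cu2).pow 2)) _ _
          · intro x _
            exact Finset.sum_mul_sq_le_sq_mul_sq _ _ _
      _ = S * ∑ i, ∫ x in (0:ℝ)..L, v2 i x ^ 2 := by
          rw [intervalIntegral.integral_const_mul, intervalIntegral.integral_finsetSum]
          intro i _
          exact (((hv i).cu2).pow 2).intervalIntegrable _ _
      _ ≤ S * ∑ i : ι, (2 * (Q ^ 2 + 1)) := by
          gcongr with i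
          exact hup1 i
      _ = _ := by rw [Finset.sum_const, Finset.card_univ, hι, nsmul_eq_mul]
  -- lower bound
  have hlow : S / 2 ≤ ∫ x in (0:ℝ)..L, (∑ i, c i * v i x) ^ 2 := by
    have e : ∫ x in (0:ℝ)..L, (∑ i, c i * v i x) ^ 2 =
        ∑ i, ∑ j, c i * c j * ∫ x in (0:ℝ)..L, v i x * v j x := by
      have e1 : ∀ x, (∑ i, c i * v i x) ^ 2 = ∑ i, ∑ j, c i * c j * (v i x * v j x) := by
        intro x
        rw [sq, Finset.sum_mul_sum]
        refine Finset.sum_congr rfl fun i _ => Finset.sum_congr rfl fun j _ => by ring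
      simp only [e1]
      have ii : ∀ i j, IntervalIntegrable (fun x => c i * c j * (v i x * v j x)) volume 0 L := fun i j =>
        (continuous_const.mul ((hv i).cu.mul (hv j).cu)).intervalIntegrable _ _
      rw [intervalIntegral.integral_finsetSum]
      · refine Finset.sum_congr rfl fun i _ => ?_
        rw [intervalIntegral.integral_finsetSum]
        · refine Finset.sum_congr rfl fun j _ => ?_
          rw [intervalIntegral.integral_const_mul]
        · exact fun j _ => ii i j
      · intro i _
        exact (continuous_finsetSum _ fun j _ => continuous_const.mul ((hv i).cu.mul (hv j).cu)).intervalIntegrable _ _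
    rw [e]
    have hterm : ∀ i j, (if i = j then c i ^ 2 else 0) - |c i| * |c j| * (1 / (2 * m)) ≤
        c i * c j * ∫ x in (0:ℝ)..L, v i x * v j x := by
      intro i j
      by_cases hij : i = j
      · subst hij
        have : ∫ x in (0:ℝ)..L, v i x * v i x = 1 := by rw [← nv i]; simp only [sq]
        rw [if_pos rfl, this]
        have : 0 ≤ |c i| * |c i| * (1 / (2 * (m:ℝ))) := by positivity
        nlinarith
      · rw [if_neg hij]
        have h1 : |c i * c j * ∫ x in (0:ℝ)..L, v i x * v j x| ≤ |c i| * |c j| * (1 / (2 * m)) := by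
          rw [abs_mul, abs_mul]
          gcongr
          exact horth i j hij
        linarith [(abs_le.1 h1).1]
    have hsum : ∑ i, ∑ j, ((if i = j then c i ^ 2 else 0) - |c i| * |c j| * (1 / (2 * m))) =
        S - (∑ i, |c i|) ^ 2 * (1 / (2 * m)) := by
      simp only [Finset.sum_sub_distrib]
      congr 1
      · simp [hS]
      · rw [sq, Finset.sum_mul_sum, Finset.sum_mul]
        simp only [Finset.sum_mul]
    have hcs : (∑ i, |c i|) ^ 2 ≤ m * S := by
      have := sq_sum_le_card_mul_sum_sq (s := Finset.univ) (f := fun i => |c i|)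
      simpa [hι, hS] using this
    calc S / 2 = S - m * S * (1 / (2 * m)) := by field_simp; ring
      _ ≤ S - (∑ i, |c i|) ^ 2 * (1 / (2 * m)) := by gcongr
      _ = _ := hsum.symm
      _ ≤ _ := Finset.sum_le_sum fun i _ => Finset.sum_le_sum fun j _ => hterm i j
  have hfin : S / 2 ≤ h ^ 4 * (S * (m * (2 * (Q ^ 2 + 1)))) :=
    hlow.trans (hgrid.trans (by gcongr))
  nlinarith

lemma sep_measure {r : ℝ} (hr : 0 ≤ r) (m : ℕ) (S : Set ℝ)
    (h : ∀ F : Finset ℝ, ↑F ⊆ S → (∀ x ∈ F, ∀ y ∈ F, x ≠ y → r ≤ |x - y|) → F.card ≠ m) :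
    volume S ≤ ENNReal.ofReal (2 * r * m) := by
  induction m with
  | zero => exact absurd rfl (h ∅ (by simp) (by simp))
  | succ m ih =>
    by_cases hF : ∃ F : Finset ℝ, ↑F ⊆ S ∧ (∀ x ∈ F, ∀ y ∈ F, x ≠ y → r ≤ |x - y|) ∧ F.card = m
    · obtain ⟨F, hFS, hsep, hcard⟩ := hF
      have hcov : S ⊆ ⋃ e ∈ F, Icc (e - r) (e + r) := by
        intro x hx
        by_contra hcon
        simp only [mem_iUnion, not_exists] at hcon
        have hx1 : ∀ e ∈ F, r ≤ |x - e| := by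
          intro e he
          by_contra hlt
          push Not at hlt
          rw [abs_lt] at hlt
          exact hcon e he ⟨by linarith [hlt.1], by linarith [hlt.2]⟩
        have hxF : x ∉ F := by
          intro hxF
          exact hcon x hxF ⟨by linarith, by linarith⟩
        refine h (insert x F) ?_ ?_ ?_
        · rw [Finset.coe_insert]; exact insert_subset hx hFS
        · intro a ha b hb hab
          rw [Finset.mem_insert] at ha hb
          rcases ha with rfl | ha <;> rcases hb with rfl | hb
          · exact absurd rfl hab
          · exact hx1 b hb
          · rw [abs_sub_comm]; exact hx1 a ha
          · exact hsep a ha b hb hab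
        · rw [Finset.card_insert_of_notMem hxF, hcard]
      calc volume S ≤ volume (⋃ e ∈ F, Icc (e - r) (e + r)) := measure_mono hcov
        _ ≤ ∑ e ∈ F, volume (Icc (e - r) (e + r)) := measure_biUnion_finset_le _ _
        _ = ∑ e ∈ F, ENNReal.ofReal (2 * r) := by
          refine Finset.sum_congr rfl fun e _ => ?_
          rw [Real.volume_Icc]; congr 1; ring
        _ = ENNReal.ofReal (2 * r * m) := by
          rw [Finset.sum_const, hcard, nsmul_eq_mul, mul_comm, ENNReal.ofReal_mul (p := 2 * r) (by positivity), ENNReal.ofReal_natCast]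
        _ ≤ _ := by
          apply ENNReal.ofReal_le_ofReal
          push_cast
          nlinarith
    · push Not at hF
      refine (ih hF).trans (ENNReal.ofReal_le_ofReal ?_)
      push_cast
      nlinarith

lemma counting {L δ Q : ℝ} (hL : 0 < L) (hδ : 0 < δ) (hδ1 : δ ≤ 1) {q : ℝ → ℝ} (hq : Continuous q)
    {n m : ℕ} (hn : 0 < n) (hm : m = 2 * n + 1) (hsmall : 4 * (L / n) ^ 4 * m * (Q ^ 2 + 1) < 1)
    {S : Set ℝ} (hS : ∀ E ∈ S, Approx L δ q E) (hQ : ∀ E ∈ S, ∀ x ∈ Icc 0 L, |q x - E| ≤ Q) :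
    volume S ≤ ENNReal.ofReal (24 * m ^ 2 * δ) := by
  have := sep_measure (r := 12 * m * δ) (by positivity) m S (by
    intro F hFS hsep hcard
    refine no_sep hL hδ hδ1 hq hn hm hsmall (ι := F) (by rw [Fintype.card_coe, hcard]) (fun i => i)
      (fun i => hS _ (hFS i.2)) (fun i => hQ _ (hFS i.2)) ?_
    intro i j hij
    exact hsep _ i.2 _ j.2 (fun h => hij (Subtype.ext h)))
  refine this.trans (le_of_eq ?_)
  congr 1; ring


/-! ### Part H: reduction to real functions and localization -/

lemma cs_comb {q a a2 : ℝ → ℝ} (hs : HasCompactSupport a) (hs2 : HasCompactSupport a2) :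
    HasCompactSupport (fun x => a2 x - q x * a x) := by
  apply HasCompactSupport.intro (hs.isCompact.union hs2.isCompact)
  intro x hx
  rw [mem_union, not_or] at hx
  rw [image_eq_zero_of_notMem_tsupport hx.1, image_eq_zero_of_notMem_tsupport hx.2]
  simp

lemma sq_int_aux {a : ℝ → ℝ} (ha : Continuous a) (hs : HasCompactSupport a) :
    Integrable (fun x => a x ^ 2) volume := by
  have h1 : Continuous (fun x => a x ^ 2) := by fun_prop
  have h2 : HasCompactSupport (fun x => a x ^ 2) := by
    apply HasCompactSupport.intro hs.isCompact
    intro x hx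
    rw [image_eq_zero_of_notMem_tsupport hx]
    simp
  exact h1.integrable_of_hasCompactSupport h2

lemma f_int_aux {q a a2 : ℝ → ℝ} (hq : Continuous q) (ha : Continuous a) (ha2 : Continuous a2)
    (hs : HasCompactSupport a) (hs2 : HasCompactSupport a2) :
    Integrable (fun x => (a2 x - q x * a x) ^ 2) volume :=
  sq_int_aux (ha2.sub (hq.mul ha)) (cs_comb hs hs2)

lemma real_reduction {W : ℝ → ℝ} (hW : Continuous W) {E : ℝ} (hE : E ∈ schrodingerSpectrum W)
    {η : ℝ} (hη : 0 < η) : ∃ u u1 u2 : ℝ → ℝ, C2R u u1 u2 ∧ HasCompactSupport u ∧ HasCompactSupport u2 ∧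
      0 < ∫ x, u x ^ 2 ∧ (∫ x, (u2 x - (W x - E) * u x) ^ 2) ≤ η * ∫ x, u x ^ 2 := by
  obtain ⟨u, hu, hc, h1, h2⟩ := hE η hη
  have hd1 : ∀ x, HasDerivAt u (deriv u x) x := fun x =>
    (hu.differentiable (by norm_num) x).hasDerivAt
  have hu1 : ContDiff ℝ 1 (deriv u) := by
    have : ContDiff ℝ (1 + 1) u := hu
    exact (contDiff_succ_iff_deriv.1 this).2.2
  have hd2 : ∀ x, HasDerivAt (deriv u) (deriv (deriv u) x) x := fun x =>
    (hu1.differentiable (by norm_num) x).hasDerivAt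
  have hcu : Continuous u := hu.continuous
  have hcu2 : Continuous (deriv (deriv u)) := hu1.continuous_deriv le_rfl
  have hcs2 : HasCompactSupport (deriv (deriv u)) := hc.deriv.deriv
  -- real and imaginary parts
  have key : ∀ P : ℂ →L[ℝ] ℝ, C2R (fun x => P (u x)) (fun x => P (deriv u x)) (fun x => P (deriv (deriv u) x)) ∧
      HasCompactSupport (fun x => P (u x)) ∧ HasCompactSupport (fun x => P (deriv (deriv u) x)) := by
    intro P
    refine ⟨⟨fun x => ?_, fun x => ?_, P.continuous.comp hcu2⟩, ?_, ?_⟩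
    · exact P.hasFDerivAt.comp_hasDerivAt x (hd1 x)
    · exact P.hasFDerivAt.comp_hasDerivAt x (hd2 x)
    · exact hc.comp_left (map_zero P)
    · exact hcs2.comp_left (map_zero P)
  have kka : C2R (fun x => (u x).re) (fun x => (deriv u x).re) (fun x => (deriv (deriv u) x).re) ∧
      HasCompactSupport (fun x => (u x).re) ∧ HasCompactSupport (fun x => (deriv (deriv u) x).re) :=
    key Complex.reCLM
  have kkb : C2R (fun x => (u x).im) (fun x => (deriv u x).im) (fun x => (deriv (deriv u) x).im) ∧
      HasCompactSupport (fun x => (u x).im) ∧ HasCompactSupport (fun x => (deriv (deriv u) x).im) :=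
    key Complex.imCLM
  clear key
  obtain ⟨ka, sa, sa2⟩ := kka
  obtain ⟨kb, sb, sb2⟩ := kkb
  have hWE : Continuous (fun x => W x - E) := hW.sub continuous_const
  have e1 : (∫ x, (u x).re ^ 2) + (∫ x, (u x).im ^ 2) = 1 := by
    have i1 := sq_int_aux (ka.cu) sa
    have i2 := sq_int_aux (kb.cu) sb
    rw [← h1, ← integral_add i1 i2]
    congr 1
    ext x
    rw [Complex.sq_norm, Complex.normSq_apply]
    ring
  have e2 : (∫ x, ((deriv (deriv u) x).re - (W x - E) * (u x).re) ^ 2) +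
      (∫ x, ((deriv (deriv u) x).im - (W x - E) * (u x).im) ^ 2) < η := by
    refine lt_of_eq_of_lt ?_ h2
    have i1 := f_int_aux hWE ka.cu ka.cu2 sa sa2
    have i2 := f_int_aux hWE kb.cu kb.cu2 sb sb2
    rw [← integral_add i1 i2]
    congr 1
    ext x
    rw [Complex.sq_norm, Complex.normSq_apply]
    simp
    ring
  have nn : ∀ f : ℝ → ℝ, 0 ≤ ∫ x, f x ^ 2 := fun f => integral_nonneg fun x => sq_nonneg _
  by_cases hcase : (∫ x, ((deriv (deriv u) x).re - (W x - E) * (u x).re) ^ 2) < η * ∫ x, (u x).re ^ 2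
  · refine ⟨_, _, _, ka, sa, sa2, ?_, hcase.le⟩
    have := (nn (fun x => (deriv (deriv u) x).re - (W x - E) * (u x).re)).trans_lt hcase
    exact (pos_iff_pos_of_mul_pos this).1 hη
  · push Not at hcase
    have hb : (∫ x, ((deriv (deriv u) x).im - (W x - E) * (u x).im) ^ 2) < η * ∫ x, (u x).im ^ 2 := by
      have : η * (∫ x, (u x).re ^ 2) + η * (∫ x, (u x).im ^ 2) = η := by rw [← mul_add, e1, mul_one]
      linarith
    refine ⟨_, _, _, kb, sb, sb2, ?_, hb.le⟩
    have := (nn (fun x => (deriv (deriv u) x).im - (W x - E) * (u x).im)).trans_lt hb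
    exact (pos_iff_pos_of_mul_pos this).1 hη

lemma pigeonhole {g h : ℝ → ℝ} (hg : Continuous g) (hh : Continuous h) (hg0 : ∀ x, 0 ≤ g x)
    (hh0 : ∀ x, 0 ≤ h x) (sg : HasCompactSupport g) (sh : HasCompactSupport h)
    {L y d θ κ η α β : ℝ} (hL : 0 < L) (hθ : 0 ≤ θ) (hκ : 0 ≤ κ) (hα : 0 ≤ α) (hβ : 0 ≤ β)
    {p : ℝ → ℝ} (hp : ∀ k : ℤ, p (y + k * L) ≤ ∫ x in (y + k * L - d)..(y + k * L - d + L), (θ * g x + κ * h x))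
    (hpos : 0 < ∫ x, g x) (hη : ∫ x, h x ≤ η * ∫ x, g x) (hsm : 2 * α * (θ + κ * η) + β * η < 1) :
    ∃ k : ℤ, α * (p (y + k * L) + p (y + k * L + L)) + β * (∫ x in (y + k * L)..(y + k * L + L), h x) <
      ∫ x in (y + k * L)..(y + k * L + L), g x := by
  by_contra hcon
  push Not at hcon
  have ig : Integrable g volume := hg.integrable_of_hasCompactSupport sg
  have ih : Integrable h volume := hh.integrable_of_hasCompactSupport sh
  obtain ⟨r, hr⟩ := sg.isCompact.isBounded.subset_closedBall y
  obtain ⟨m, hm⟩ := exists_nat_gt (r / L)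
  have hmL : r < m * L := by rwa [div_lt_iff₀ hL] at hm
  -- partition points
  set a : ℕ → ℝ := fun k => y + ((k:ℤ) - (m:ℤ) : ℤ) * L with ha
  have ha1 : ∀ k, a (k + 1) = a k + L := by intro k; simp only [ha]; push_cast; ring
  have adj : ∀ (F : ℝ → ℝ), Continuous F → ∀ (c : ℝ) (n : ℕ),
      ∑ k ∈ Finset.range n, ∫ x in (a k - c)..(a k - c + L), F x = ∫ x in (a 0 - c)..(a n - c), F x := by
    intro F hF c n
    have := intervalIntegral.sum_integral_adjacent_intervals (f := F) (μ := volume)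
      (a := fun k : ℕ => a k - c) (n := n) (fun k _ => hF.intervalIntegrable _ _)
    rw [← this]
    refine Finset.sum_congr rfl fun k _ => ?_
    rw [ha1, show a k + L - c = a k - c + L by ring]
  have amono : ∀ n, a 0 ≤ a n := by
    intro n
    simp only [ha]
    push_cast
    have : 0 ≤ (n:ℝ) * L := by positivity
    nlinarith
  have le_full : ∀ (F : ℝ → ℝ), Integrable F volume → (∀ x, 0 ≤ F x) → ∀ s t : ℝ, s ≤ t →
      ∫ x in s..t, F x ≤ ∫ x, F x := by
    intro F hF hF0 s t hst
    rw [intervalIntegral.integral_of_le hst]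
    exact setIntegral_le_integral hF (Eventually.of_forall hF0)
  -- the sum of point values
  have hG : Continuous (fun x => θ * g x + κ * h x) := by fun_prop
  have sump : ∀ n, ∑ k ∈ Finset.range n, p (a k) ≤ (θ + κ * η) * ∫ x, g x := by
    intro n
    calc _ ≤ ∑ k ∈ Finset.range n, ∫ x in (a k - d)..(a k - d + L), (θ * g x + κ * h x) :=
          Finset.sum_le_sum fun k _ => hp _
      _ = ∫ x in (a 0 - d)..(a n - d), (θ * g x + κ * h x) := adj _ hG d n
      _ ≤ ∫ x, (θ * g x + κ * h x) := by
          apply le_full _ ((ig.const_mul θ).add (ih.const_mul κ))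
          · intro x
            exact add_nonneg (mul_nonneg hθ (hg0 x)) (mul_nonneg hκ (hh0 x))
          · linarith [amono n]
      _ = θ * (∫ x, g x) + κ * ∫ x, h x := by
          rw [integral_add (ig.const_mul θ) (ih.const_mul κ), integral_const_mul, integral_const_mul]
      _ ≤ θ * (∫ x, g x) + κ * (η * ∫ x, g x) := by gcongr
      _ = _ := by ring
  have sump' : ∀ n, ∑ k ∈ Finset.range n, p (a k + L) ≤ (θ + κ * η) * ∫ x, g x := by
    intro n
    simp only [← ha1]
    calc ∑ k ∈ Finset.range n, p (a (k + 1)) ≤ ∑ k ∈ Finset.range n, ∫ x in (a k - (d - L))..(a k - (d - L) + L), (θ * g x + κ * h x) := by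
          refine Finset.sum_le_sum fun k _ => ?_
          have := hp (((k + 1 : ℕ) : ℤ) - (m:ℤ))
          have e : a k - (d - L) = a (k + 1) - d := by rw [ha1]; ring
          rw [e]
          exact this
      _ = ∫ x in (a 0 - (d - L))..(a n - (d - L)), (θ * g x + κ * h x) := adj _ hG (d - L) n
      _ ≤ ∫ x, (θ * g x + κ * h x) := by
          apply le_full _ ((ig.const_mul θ).add (ih.const_mul κ))
          · intro x
            exact add_nonneg (mul_nonneg hθ (hg0 x)) (mul_nonneg hκ (hh0 x))
          · linarith [amono n]
      _ = θ * (∫ x, g x) + κ * ∫ x, h x := by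
          rw [integral_add (ig.const_mul θ) (ih.const_mul κ), integral_const_mul, integral_const_mul]
      _ ≤ θ * (∫ x, g x) + κ * (η * ∫ x, g x) := by gcongr
      _ = _ := by ring
  have hfull : ∫ x in (a 0)..(a (2 * m)), g x = ∫ x, g x := by
    apply intervalIntegral.integral_eq_integral_of_support_subset
    intro x hx
    have := hr (subset_tsupport g hx)
    rw [Metric.mem_closedBall, Real.dist_eq, abs_le] at this
    simp only [ha]
    push_cast
    constructor <;> nlinarith [this.1, this.2]
  have a1 := adj g hg 0 (2 * m)
  have a2 := adj h hh 0 (2 * m)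
  simp only [sub_zero] at a1 a2
  have hfin : ∫ x, g x ≤ (2 * α * (θ + κ * η) + β * η) * ∫ x, g x := by
    calc ∫ x, g x = ∑ k ∈ Finset.range (2 * m), ∫ x in (a k)..(a k + L), g x := by rw [a1, hfull]
      _ ≤ ∑ k ∈ Finset.range (2 * m), (α * (p (a k) + p (a k + L)) + β * ∫ x in (a k)..(a k + L), h x) :=
          Finset.sum_le_sum fun k _ => hcon _
      _ = α * (∑ k ∈ Finset.range (2 * m), p (a k) + ∑ k ∈ Finset.range (2 * m), p (a k + L)) +
            β * ∫ x in (a 0)..(a (2 * m)), h x := by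
          rw [← a2, Finset.sum_add_distrib, ← Finset.mul_sum, ← Finset.mul_sum, Finset.sum_add_distrib]
      _ ≤ α * ((θ + κ * η) * (∫ x, g x) + (θ + κ * η) * ∫ x, g x) + β * (η * ∫ x, g x) := by
          gcongr
          · exact sump _
          · exact sump' _
          · exact (le_full h ih hh0 _ _ (amono _)).trans hη
      _ = _ := by ring
  nlinarith



/-! ### Part I: decay across a wall -/

lemma TM_bound {T : ℝ} (hT : 0 < T) {q : ℝ → ℝ} (hq : Continuous q) {K : ℝ} (hK1 : 1 ≤ K)
    (hK : ∀ x ∈ Icc 0 T, |q x| ≤ K) (i j : Fin 2) : |TM T q i j| ≤ Real.exp (K * T) := by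
  obtain ⟨u, u1, hu, h0, h1, hb⟩ := ode_exists hq hT hK1 hK 1 0
  obtain ⟨v, v1, hv, k0, k1, kb⟩ := ode_exists hq hT hK1 hK 0 1
  have eu := (TM_spec hT hq).exact hq hu
  have ev := (TM_spec hT hq).exact hq hv
  have bu := hb T ⟨hT.le, le_rfl⟩
  have bv := kb T ⟨hT.le, le_rfl⟩
  rw [h0, h1] at eu
  rw [k0, k1] at ev
  simp only [mul_one, mul_zero, add_zero, zero_add] at eu ev
  simp only [eu, ev, abs_one, abs_zero, zero_le_one, sup_of_le_left, sup_of_le_right, one_mul] at bu bv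
  fin_cases i <;> fin_cases j
  · exact bu.1
  · exact bv.1
  · exact bu.2
  · exact bv.2

lemma cell_le {F : ℝ → ℝ} (hF : Continuous F) (hF0 : ∀ x, 0 ≤ F x) {T L a b : ℝ} (hT : 0 < T)
    (hab : a ≤ b) (hb : b + T ≤ a + L) :
    ∫ x in (0:ℝ)..T, F (b + x) ≤ ∫ x in a..(a + L), F x := by
  rw [intervalIntegral.integral_comp_add_left (fun x => F x) b, add_zero]
  exact intervalIntegral.integral_mono_interval hab (by linarith) hb
    (Eventually.of_forall fun x => hF0 x) (hF.intervalIntegrable _ _)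

lemma wall_window {T : ℝ} (hT : 0 < T) {C : ℝ} (hC : 0 ≤ C)
    (hCs : ∀ u u1 u2, C2on T u u1 u2 →
      u 0 ^ 2 ≤ C * ∫ x in (0:ℝ)..T, (u x ^ 2 + u2 x ^ 2) ∧
      u1 0 ^ 2 ≤ C * ∫ x in (0:ℝ)..T, (u x ^ 2 + u2 x ^ 2))
    {n : ℕ} {q : ℕ → ℝ → ℝ} (hqc : ∀ j, Continuous (q j)) (hqper : ∀ j, q (j + n) = q j)
    {Q : ℝ} (hQ1 : 1 ≤ Q) (hQ : ∀ j, ∀ x ∈ Icc 0 T, |q j x| ≤ Q) {τ : ℝ} (hτ : 0 < τ)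
    (htr : 2 + τ ≤ |(prodM (fun j => TM T (q j)) n).trace|) (K : ℕ) :
    ∃ κ : ℝ, 0 ≤ κ ∧ ∀ (W : ℝ → ℝ), Continuous W → (∀ x, |W x| ≤ Q) →
      ∀ a L : ℝ, ((2 * K * n : ℕ) + 1) * T ≤ L →
      (∀ j : ℕ, j < 2 * K * n → ∀ x ∈ Icc 0 T, W (a + j * T + x) = q j x) →
      ∀ u u1 u2 : ℝ → ℝ, C2R u u1 u2 →
      u (a + (K * n : ℕ) * T) ^ 2 + u1 (a + (K * n : ℕ) * T) ^ 2 ≤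
        ∫ x in a..(a + L), ((4 * C * (1 + 2 * Q ^ 2) * ((2 / (2 + τ)) ^ K) ^ 2) * (u x ^ 2) +
          κ * (u2 x - W x * u x) ^ 2) := by
  set B := Real.exp (Q * T) with hBdef
  have hB : 1 ≤ B := Real.one_le_exp (by positivity)
  set Cw := (2 + (2 * B) ^ n) * (n * (2 * B) ^ n) with hCw
  have hCw0 : 0 ≤ Cw := by positivity
  set ρ := (2 / (2 + τ)) ^ K with hρ
  have hρ0 : 0 ≤ ρ := by positivity
  refine ⟨8 * C * ρ ^ 2 + 16 * K ^ 2 * Cw ^ 2 * B ^ 4 * T, by positivity, ?_⟩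
  intro W hW hWQ a L hL hcell u u1 u2 hu
  have cu := hu.cu
  have cu1 := hu.cu1
  have cu2 := hu.cu2
  have hjL : ∀ j : ℕ, j ≤ 2 * K * n → a + j * T + T ≤ a + L := by
    intro j hj
    have : (j:ℝ) ≤ (2 * K * n : ℕ) := by exact_mod_cast hj
    nlinarith
  have hja : ∀ j : ℕ, a ≤ a + j * T := by
    intro j
    have : 0 ≤ (j:ℝ) * T := by positivity
    linarith
  have ch : Continuous (fun x => (u2 x - W x * u x) ^ 2) := by fun_prop
  set Ih := ∫ x in a..(a + L), (u2 x - W x * u x) ^ 2 with hIh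
  set Ig := ∫ x in a..(a + L), u x ^ 2 with hIg
  have hL0 : 0 ≤ L := le_trans (by positivity) hL
  have hIh0 : 0 ≤ Ih := intervalIntegral.integral_nonneg (by linarith) fun x _ => sq_nonneg _
  have hIg0 : 0 ≤ Ig := intervalIntegral.integral_nonneg (by linarith) fun x _ => sq_nonneg _
  set U : ℕ → Fin 2 → ℝ := fun j => ![u (a + j * T), u1 (a + j * T)] with hU
  set A := Real.sqrt (C * ((1 + 2 * Q ^ 2) * Ig + 2 * Ih)) with hA
  set G := Real.sqrt (4 * B ^ 4 * T * Ih) with hG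
  have hA2 : A ^ 2 = C * ((1 + 2 * Q ^ 2) * Ig + 2 * Ih) := Real.sq_sqrt (by positivity)
  have hG2 : G ^ 2 = 4 * B ^ 4 * T * Ih := Real.sq_sqrt (by positivity)
  have hsh : ∀ j : ℕ, C2on T (fun x => u (a + j * T + x)) (fun x => u1 (a + j * T + x))
      (fun x => u2 (a + j * T + x)) := by
    intro j
    have := (hu.shift (a + j * T) 1).on T
    simpa only [one_mul] using this
  have step1 : ∀ j ≤ 2 * K * n, ‖U j‖ ≤ A := by
    intro j hj
    have hs := hCs _ _ _ (hsh j)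
    simp only [add_zero] at hs
    have hle : ∫ x in (0:ℝ)..T, (u (a + j * T + x) ^ 2 + u2 (a + j * T + x) ^ 2) ≤
        (1 + 2 * Q ^ 2) * Ig + 2 * Ih := by
      have h1 : ∫ x in (0:ℝ)..T, (u (a + j * T + x) ^ 2 + u2 (a + j * T + x) ^ 2) ≤
          ∫ x in a..(a + L), (u x ^ 2 + u2 x ^ 2) :=
        cell_le (F := fun x => u x ^ 2 + u2 x ^ 2) (by fun_prop) (fun x => by positivity) hT (hja j) (hjL j hj)
      have h2 : ∫ x in a..(a + L), (u x ^ 2 + u2 x ^ 2) ≤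
          ∫ x in a..(a + L), ((1 + 2 * Q ^ 2) * u x ^ 2 + 2 * (u2 x - W x * u x) ^ 2) := by
        apply intervalIntegral.integral_mono_on (by linarith)
        · exact Continuous.intervalIntegrable (by fun_prop) _ _
        · exact Continuous.intervalIntegrable (by fun_prop) _ _
        · intro x _
          have hw : W x ^ 2 ≤ Q ^ 2 := sq_le_sq.2 (by rw [abs_of_pos (by linarith : 0 < Q)]; exact hWQ x)
          have hw2 : W x ^ 2 * u x ^ 2 ≤ Q ^ 2 * u x ^ 2 := by gcongr
          nlinarith [sq_nonneg (u2 x - 2 * (W x * u x))]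
      refine h1.trans (h2.trans_eq ?_)
      rw [intervalIntegral.integral_add (Continuous.intervalIntegrable (by fun_prop) _ _)
        (Continuous.intervalIntegrable (by fun_prop) _ _), intervalIntegral.integral_const_mul,
        intervalIntegral.integral_const_mul]
    have hle' := mul_le_mul_of_nonneg_left hle hC
    rw [pi_norm_le_iff_of_nonneg (Real.sqrt_nonneg _)]
    intro i
    fin_cases i
    · exact Real.abs_le_sqrt (hs.1.trans hle')
    · exact Real.abs_le_sqrt (hs.2.trans hle')
  have step2 : ∀ j < 2 * K * n, ‖U (j + 1) - Matrix.mulVec (TM T (q j)) (U j)‖ ≤ G := by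
    intro j hj
    have ht := (TM_spec hT (hqc j)).2 Q hQ1 (hQ j) _ _ _ (hsh j)
    have hint : ∫ x in (0:ℝ)..T, |u2 (a + j * T + x) - q j x * u (a + j * T + x)| =
        ∫ x in (0:ℝ)..T, |u2 (a + j * T + x) - W (a + j * T + x) * u (a + j * T + x)| := by
      apply intervalIntegral.integral_congr
      intro x hx
      rw [uIcc_of_le hT.le] at hx
      simp only [hcell j hj x hx]
    have hcs := interval_cs_one hT.le
      (g := fun x => |u2 (a + j * T + x) - W (a + j * T + x) * u (a + j * T + x)|)
      (Continuous.continuousOn (by fun_prop))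
    simp only [sq_abs, sub_zero] at hcs
    have hc2 : ∫ x in (0:ℝ)..T, (u2 (a + j * T + x) - W (a + j * T + x) * u (a + j * T + x)) ^ 2 ≤ Ih :=
      cell_le (F := fun x => (u2 x - W x * u x) ^ 2) ch (fun x => sq_nonneg _) hT (hja j) (hjL j hj.le)
    rw [hint] at ht
    set J := ∫ x in (0:ℝ)..T, |u2 (a + j * T + x) - W (a + j * T + x) * u (a + j * T + x)| with hJ
    have hJ0 : 0 ≤ J := intervalIntegral.integral_nonneg hT.le fun x _ => abs_nonneg _
    have hJG : 2 * B ^ 2 * J ≤ G := by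
      apply Real.le_sqrt_of_sq_le
      have : J ^ 2 ≤ T * Ih := hcs.trans (mul_le_mul_of_nonneg_left hc2 hT.le)
      calc (2 * B ^ 2 * J) ^ 2 = 4 * B ^ 4 * J ^ 2 := by ring
        _ ≤ 4 * B ^ 4 * (T * Ih) := by gcongr
        _ = _ := by ring
    simp only [add_zero] at ht
    have e : a + j * T + T = a + ((j + 1 : ℕ) : ℝ) * T := by push_cast; ring
    rw [e] at ht
    rw [pi_norm_le_iff_of_nonneg (Real.sqrt_nonneg _)]
    intro i
    rw [Real.norm_eq_abs]
    fin_cases i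
    · refine le_trans ?_ hJG
      simpa [hU, Matrix.mulVec, dotProduct, Fin.sum_univ_two] using ht.1
    · refine le_trans ?_ hJG
      simpa [hU, Matrix.mulVec, dotProduct, Fin.sum_univ_two] using ht.2
  have hdec := wall_decay (f := fun j => TM T (q j)) (fun j => by simp only [hqper])
    (fun j => TM_det hT (hqc j)) hB (fun j i k => TM_bound hT (hqc j) hQ1 (hQ j) i k) hτ htr
    (Real.sqrt_nonneg _) (Real.sqrt_nonneg _) step2 step1
  have hn0 : |u (a + (K * n : ℕ) * T)| ≤ ‖U (K * n)‖ := norm_le_pi_norm (U (K * n)) 0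
  have hn1 : |u1 (a + (K * n : ℕ) * T)| ≤ ‖U (K * n)‖ := norm_le_pi_norm (U (K * n)) 1
  rw [intervalIntegral.integral_add (Continuous.intervalIntegrable (by fun_prop) _ _)
        (Continuous.intervalIntegrable (by fun_prop) _ _), intervalIntegral.integral_const_mul,
        intervalIntegral.integral_const_mul]
  set X := ‖U (K * n)‖ with hX
  have hX0 : 0 ≤ X := norm_nonneg _
  have b0 : u (a + (K * n : ℕ) * T) ^ 2 ≤ X ^ 2 := sq_le_sq.2 (by rwa [abs_of_nonneg hX0])
  have b1 : u1 (a + (K * n : ℕ) * T) ^ 2 ≤ X ^ 2 := sq_le_sq.2 (by rwa [abs_of_nonneg hX0])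
  have hX2 : X ^ 2 ≤ 2 * (ρ * A) ^ 2 + 2 * (K * Cw * G) ^ 2 := by
    have : X ^ 2 ≤ (ρ * A + K * Cw * G) ^ 2 := pow_le_pow_left₀ hX0 hdec 2
    nlinarith [sq_nonneg (ρ * A - K * Cw * G)]
  rw [mul_pow, hA2, mul_pow _ G, hG2] at hX2
  calc _ ≤ 2 * (2 * (ρ ^ 2 * (C * ((1 + 2 * Q ^ 2) * Ig + 2 * Ih))) +
        2 * ((K * Cw) ^ 2 * (4 * B ^ 4 * T * Ih))) := by linarith
    _ = _ := by ring



lemma wall_approx {T : ℝ} (hT : 0 < T) {C : ℝ} (hC : 0 ≤ C)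
    (hCs : ∀ u u1 u2, C2on T u u1 u2 →
      u 0 ^ 2 ≤ C * ∫ x in (0:ℝ)..T, (u x ^ 2 + u2 x ^ 2) ∧
      u1 0 ^ 2 ≤ C * ∫ x in (0:ℝ)..T, (u x ^ 2 + u2 x ^ 2))
    {n : ℕ} {q : ℕ → ℝ → ℝ} (hqc : ∀ j, Continuous (q j)) (hqper : ∀ j, q (j + n) = q j)
    {Q : ℝ} (hQ1 : 1 ≤ Q) (hQ : ∀ j, ∀ x ∈ Icc 0 T, |q j x| ≤ Q) {τ : ℝ} (hτ : 0 < τ)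
    (htr : 2 + τ ≤ |(prodM (fun j => TM T (q j)) n).trace|) (K : ℕ)
    {W : ℝ → ℝ} (hW : Continuous W) {L : ℝ} (hper : Function.Periodic W L) {E : ℝ}
    (hE : E ∈ schrodingerSpectrum W) (hWQ : ∀ x, |W x - E| ≤ Q)
    (hL : ((2 * K * n : ℕ) + 1) * T ≤ L) {a : ℝ}
    (hcell : ∀ j : ℕ, j < 2 * K * n → ∀ x ∈ Icc 0 T, W (a + j * T + x) - E = q j x)
    {δ : ℝ} (hδ : 0 < δ)
    (hδ2 : 2 * (4 * C * (1 + 2 * Q ^ 2) * ((2 / (2 + τ)) ^ K) ^ 2) < δ ^ 2) :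
    Approx L δ (fun x => W (a + (K * n : ℕ) * T + x)) E := by
  obtain ⟨κ, hκ, hwin⟩ := wall_window hT hC hCs hqc hqper hQ1 hQ hτ htr K
  set θ := 4 * C * (1 + 2 * Q ^ 2) * ((2 / (2 + τ)) ^ K) ^ 2 with hθ
  have hθ0 : 0 ≤ θ := by positivity
  have hL0 : 0 < L := lt_of_lt_of_le (by positivity) hL
  set η := (δ ^ 2 - 2 * θ) / (2 * (2 * κ + 1)) with hη
  have hη0 : 0 < η := div_pos (by linarith) (by positivity)
  obtain ⟨u, u1, u2, hu, su, su2, hpos, hint⟩ := real_reduction hW hE hη0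
  have cu := hu.cu
  have cu1 := hu.cu1
  have cu2 := hu.cu2
  have sg : HasCompactSupport (fun x => u x ^ 2) := by
    apply HasCompactSupport.intro su.isCompact
    intro x hx
    rw [image_eq_zero_of_notMem_tsupport hx]
    simp
  have sh0 := cs_comb (q := fun x => W x - E) su su2
  have sh : HasCompactSupport (fun x => (u2 x - (W x - E) * u x) ^ 2) := by
    apply HasCompactSupport.intro sh0.isCompact
    intro x hx
    rw [image_eq_zero_of_notMem_tsupport hx]
    simp
  set y := a + (K * n : ℕ) * T with hy
  have hα : 2 * (δ ^ 2)⁻¹ * (θ + κ * η) + (δ ^ 2)⁻¹ * η < 1 := by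
    have h1 : (2 * κ + 1) * η = (δ ^ 2 - 2 * θ) / 2 := by
      rw [hη]; field_simp
    have h2 : 2 * (δ ^ 2)⁻¹ * (θ + κ * η) + (δ ^ 2)⁻¹ * η = (δ ^ 2)⁻¹ * (2 * θ + (2 * κ + 1) * η) := by ring
    rw [h2, h1, inv_mul_lt_iff₀ (by positivity)]
    linarith
  obtain ⟨k, hk⟩ := pigeonhole (g := fun x => u x ^ 2) (h := fun x => (u2 x - (W x - E) * u x) ^ 2)
    (by fun_prop) (by fun_prop) (fun x => sq_nonneg _) (fun x => sq_nonneg _) sg sh (L := L) (y := y)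
    (d := (K * n : ℕ) * T) (α := (δ ^ 2)⁻¹) (β := (δ ^ 2)⁻¹) hL0 hθ0 hκ (by positivity) (by positivity)
    (p := fun x => u x ^ 2 + u1 x ^ 2) (by
      intro k
      have := hwin (fun x => W x - E) (by fun_prop) hWQ (a + k * L) L hL (by
        intro j hj x hx
        rw [← hcell j hj x hx]
        have := hper.int_mul k (a + j * T + x)
        rw [← this]
        congr 2
        ring) u u1 u2 hu
      have e1 : a + k * L + (K * n : ℕ) * T = y + k * L := by rw [hy]; ring
      have e2 : y + k * L - (K * n : ℕ) * T = a + k * L := by rw [hy]; ring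
      rw [e1] at this
      simp only [e2]
      exact this) hpos hint hα
  set z := y + k * L with hz
  set I := ∫ x in z..(z + L), u x ^ 2 with hI
  set H := ∫ x in z..(z + L), (u2 x - (W x - E) * u x) ^ 2 with hH
  have hH0 : 0 ≤ H := intervalIntegral.integral_nonneg (by linarith) fun x _ => sq_nonneg _
  have hI0 : 0 < I := lt_of_le_of_lt (by positivity) hk
  have hδ0 : 0 < δ ^ 2 := by positivity
  have hk' : u z ^ 2 + u1 z ^ 2 + (u (z + L) ^ 2 + u1 (z + L) ^ 2) + H < δ ^ 2 * I := by
    rw [← inv_mul_lt_iff₀ hδ0]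
    linarith
  set c := (Real.sqrt I)⁻¹ with hc
  have hc2 : c ^ 2 * I = 1 := by
    rw [hc, inv_pow, Real.sq_sqrt hI0.le, inv_mul_cancel₀ hI0.ne']
  have hc20 : 0 ≤ c ^ 2 := sq_nonneg c
  have bd : ∀ t, t ^ 2 ≤ δ ^ 2 * I → |c * t| ≤ δ := by
    intro t ht
    apply abs_le_of_sq_le_sq _ hδ.le
    calc (c * t) ^ 2 = c ^ 2 * t ^ 2 := by ring
      _ ≤ c ^ 2 * (δ ^ 2 * I) := by gcongr
      _ = (c ^ 2 * I) * δ ^ 2 := by ring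
      _ = δ ^ 2 := by rw [hc2, one_mul]
  have n1 := sq_nonneg (u z)
  have n2 := sq_nonneg (u1 z)
  have n3 := sq_nonneg (u (z + L))
  have n4 := sq_nonneg (u1 (z + L))
  refine ⟨_, _, _, hu.shift z c, ?_, ?_, ?_, ?_, ?_, ?_⟩
  · have : ∫ x in (0:ℝ)..L, (c * u (z + x)) ^ 2 = ∫ x in (0:ℝ)..L, c ^ 2 * (fun t => u t ^ 2) (z + x) := by
      congr 1; ext x; simp only; ring
    rw [this, intervalIntegral.integral_const_mul,
      intervalIntegral.integral_comp_add_left (fun t => u t ^ 2) z, add_zero]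
    exact hc2
  · simp only [add_zero]; exact bd _ (by linarith)
  · simp only [add_zero]; exact bd _ (by linarith)
  · exact bd _ (by linarith)
  · exact bd _ (by linarith)
  · have : ∫ x in (0:ℝ)..L, (c * u2 (z + x) - (W (y + x) - E) * (c * u (z + x))) ^ 2 =
        ∫ x in (0:ℝ)..L, c ^ 2 * (fun t => (u2 t - (W t - E) * u t) ^ 2) (z + x) := by
      congr 1; ext x; simp only
      have e : W (z + x) = W (y + x) := by
        rw [← hper.int_mul k (y + x), hz]
        congr 1; ring
      rw [e]
      ring
    rw [this, intervalIntegral.integral_const_mul,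
      intervalIntegral.integral_comp_add_left (fun t => (u2 t - (W t - E) * u t) ^ 2) z, add_zero]
    calc c ^ 2 * H ≤ c ^ 2 * (δ ^ 2 * I) := by gcongr; linarith
      _ = (c ^ 2 * I) * δ ^ 2 := by ring
      _ = δ ^ 2 := by rw [hc2, one_mul]



/-! ### Part L: the potential -/

lemma periodize {T : ℝ} (hT : 0 < T) {N : ℕ} (hN : 0 < N) {c : ℕ → ℝ → ℝ} (hc : ∀ j, Continuous (c j))
    {ε : ℝ} (hb : ∀ j x, |c j x| ≤ ε) (hz : ∀ j x, x ∉ Ioo 0 T → c j x = 0) :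
    ∃ D : ℝ → ℝ, Continuous D ∧ Function.Periodic D (N * T) ∧ (∀ x, |D x| ≤ ε) ∧
      ∀ j < N, ∀ t ∈ Icc 0 T, D (j * T + t) = c j t := by
  set L : ℝ := N * T with hL
  have hNr : (0:ℝ) < N := by exact_mod_cast hN
  have hL0 : 0 < L := by positivity
  set φ : ℝ → ℝ := fun y => ∑ i ∈ Finset.range N, c i (y - i * T) with hφ
  have hφc : Continuous φ := by
    apply continuous_finsetSum
    intro i _
    have := hc i
    fun_prop
  have hcell : ∀ j < N, ∀ t ∈ Icc 0 T, φ (j * T + t) = c j t := by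
    intro j hj t ht
    simp only [hφ]
    rw [Finset.sum_eq_single j]
    · congr 1; ring
    · intro i _ hij
      apply hz
      intro h
      rcases lt_or_gt_of_ne hij with h1 | h1
      · have : (i:ℝ) + 1 ≤ j := by exact_mod_cast h1
        nlinarith [h.1, h.2, ht.1, ht.2]
      · have : (j:ℝ) + 1 ≤ i := by exact_mod_cast h1
        nlinarith [h.1, h.2, ht.1, ht.2]
    · intro h
      exact absurd (Finset.mem_range.2 hj) h
  have h0T : ∀ j, c j 0 = 0 := fun j => hz j 0 (by simp)
  have hTT : ∀ j, c j T = 0 := fun j => hz j T (by simp)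
  have hφ0 : φ 0 = 0 := by
    have := hcell 0 hN 0 ⟨le_rfl, hT.le⟩
    simpa [h0T] using this
  have hφL : φ L = 0 := by
    have := hcell (N - 1) (by omega) T ⟨hT.le, le_rfl⟩
    rw [hTT, Nat.cast_sub (by omega)] at this
    rw [← this]
    congr 1
    push_cast
    ring
  set f : ℝ → ℝ := fun s => φ (L * s) with hf
  have hf01 : f 0 = f 1 := by simp [hf, hφ0, hφL]
  have hfr : ∀ s ∈ Icc (0:ℝ) 1, f (Int.fract s) = f s := by
    intro s hs
    rcases eq_or_lt_of_le hs.2 with h | h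
    · rw [h, Int.fract_one, hf01]
    · rw [Int.fract_eq_self.2 ⟨hs.1, h⟩]
  have hfc : Continuous (f ∘ Int.fract) := by
    apply ContinuousOn.comp_fract'' _ hf01
    exact Continuous.continuousOn (by fun_prop)
  refine ⟨fun x => (f ∘ Int.fract) (x / L), hfc.comp (continuous_id.div_const L), ?_, ?_, ?_⟩
  · intro x
    simp only [Function.comp]
    rw [add_div, div_self hL0.ne', Int.fract_add_one]
  · intro x
    simp only [Function.comp, hf]
    set s := Int.fract (x / L) with hs
    have hs0 : 0 ≤ s := Int.fract_nonneg _
    have hs1 : s < 1 := Int.fract_lt_one _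
    set m := ⌊N * s⌋₊ with hm
    have hm1 : (m:ℝ) ≤ N * s := Nat.floor_le (by positivity)
    have hm2 : N * s < m + 1 := Nat.lt_floor_add_one _
    have hmN : m < N := by
      have : (m:ℝ) < N := lt_of_le_of_lt hm1 (by nlinarith)
      exact_mod_cast this
    have e : L * s = m * T + (N * s - m) * T := by rw [hL]; ring
    rw [e, hcell m hmN _ ⟨mul_nonneg (by linarith) hT.le, by nlinarith⟩]
    exact hb _ _
  · intro j hj t ht
    simp only [Function.comp]
    have hj1 : (j:ℝ) + 1 ≤ N := by exact_mod_cast hj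
    have hx0 : 0 ≤ j * T + t := add_nonneg (by positivity) ht.1
    have hx1 : j * T + t ≤ L := by rw [hL]; nlinarith [ht.2]
    rw [hfr _ ⟨div_nonneg hx0 hL0.le, (div_le_one hL0).2 hx1⟩]
    simp only [hf]
    rw [mul_div_cancel₀ _ hL0.ne', hcell j hj t ht]

lemma measure_bound {T : ℝ} (hT : 0 < T) {V : ℝ → ℝ} (hV : Continuous V) (hper : Function.Periodic V T)
    {C : ℝ} (hC : 0 ≤ C)
    (hCs : ∀ u u1 u2, C2on T u u1 u2 →
      u 0 ^ 2 ≤ C * ∫ x in (0:ℝ)..T, (u x ^ 2 + u2 x ^ 2) ∧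
      u1 0 ^ 2 ≤ C * ∫ x in (0:ℝ)..T, (u x ^ 2 + u2 x ^ 2))
    {ε Λ R Q τ δ : ℝ} (hε : 0 ≤ ε) {l : List (ℕ × (ℕ → ℝ → ℝ))} (hl : ∀ w ∈ l, GoodWall T ε w)
    (hτ : 0 < τ)
    (htr : ∀ p ∈ Icc (-R) R ×ˢ Icc Λ⁻¹ Λ, ∃ w ∈ l, 2 + τ ≤ |wallTrace T V w p|) (hQ1 : 1 ≤ Q)
    (hQ : ∀ E ∈ Icc (-R) R, ∀ lam ∈ Icc Λ⁻¹ Λ, ∀ x d : ℝ, |d| ≤ ε → |lam * (V x + d) - E| ≤ Q)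
    {ns N K : ℕ} (hns : ∀ w ∈ l, w.1 ≤ ns) (hN : 2 * K * ns * l.length + 1 ≤ N)
    (hδ : 0 < δ) (hδ1 : δ ≤ 1)
    (hδ2 : 2 * (4 * C * (1 + 2 * Q ^ 2) * ((2 / (2 + τ)) ^ K) ^ 2) < δ ^ 2)
    {n m : ℕ} (hn : 0 < n) (hm : m = 2 * n + 1) (hsmall : 4 * (N * T / n) ^ 4 * m * (Q ^ 2 + 1) < 1) :
    ∃ Vt : ℝ → ℝ, Continuous Vt ∧ Function.Periodic Vt (N * T) ∧ (∀ x, |V x - Vt x| ≤ ε) ∧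
      ∀ lam ∈ Set.Icc Λ⁻¹ Λ, volume (schrodingerSpectrum (fun x => lam * Vt x) ∩ Set.Icc (-R) R)
            ≤ ENNReal.ofReal (l.length * (24 * m ^ 2 * δ)) := by
  set b := 2 * K * ns with hb
  have hN0 : 0 < N := by omega
  have hNr : (0:ℝ) < N := by exact_mod_cast hN0
  set c : ℕ → ℝ → ℝ := fun j => if h : j / b < l.length then (l[j / b]).2 (j % b) else fun _ => 0 with hc
  obtain ⟨D, hDc, hDp, hDb, hDcell⟩ := periodize hT hN0 (c := c) (ε := ε)
    (by
      intro j
      simp only [hc]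
      split_ifs with h
      · exact (hl _ (List.getElem_mem h)).2.1 _
      · exact continuous_const)
    (by
      intro j x
      simp only [hc]
      split_ifs with h
      · exact (hl _ (List.getElem_mem h)).2.2.1 _ _
      · simpa using hε)
    (by
      intro j x hx
      simp only [hc]
      split_ifs with h
      · exact (hl _ (List.getElem_mem h)).2.2.2.1 _ _ hx
      · rfl)
  have hVN : Function.Periodic V (N * T) := hper.nat_mul N
  refine ⟨fun x => V x + D x, by fun_prop, ?_, ?_, ?_⟩
  · intro x
    simp only [hVN x, hDp x]
  · intro x
    simp only [sub_add_cancel_left, abs_neg]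
    exact hDb x
  intro lam hlam
  have hWc : Continuous (fun x => lam * (V x + D x)) := by fun_prop
  have hWp : Function.Periodic (fun x => lam * (V x + D x)) (N * T) := by
    intro x
    simp only [hVN x, hDp x]
  set S : Fin l.length → Set ℝ := fun i => {E | E ∈ Icc (-R) R ∧ Approx (N * T) δ
    (fun x => lam * (V (((b * i : ℕ) * T + (K * (l[i]).1 : ℕ) * T) + x) +
      D (((b * i : ℕ) * T + (K * (l[i]).1 : ℕ) * T) + x))) E} with hS
  have hsub : schrodingerSpectrum (fun x => lam * (V x + D x)) ∩ Set.Icc (-R) R ⊆ ⋃ i, S i := by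
    rintro E ⟨hE, hER⟩
    obtain ⟨w, hw, hwt⟩ := htr (E, lam) ⟨hER, hlam⟩
    obtain ⟨i, hi, rfl⟩ := List.getElem_of_mem hw
    have hg := hl _ hw
    rw [mem_iUnion]
    refine ⟨⟨i, hi⟩, hER, ?_⟩
    set w := l[i] with hwdef
    have hwn : w.1 ≤ ns := hns w hw
    have hKb : 2 * K * w.1 ≤ b := Nat.mul_le_mul_left _ hwn
    have hbi : b * i + b ≤ b * l.length := by
      calc b * i + b = b * (i + 1) := by ring
        _ ≤ _ := Nat.mul_le_mul_left _ hi
    refine wall_approx hT hC hCs (n := w.1) (q := fun j x => lam * (V x + w.2 j x) - E) ?_ ?_ hQ1 ?_ hτ hwt K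
      hWc hWp hE ?_ ?_ ?_ hδ hδ2
    · intro j
      have := hg.2.1 j
      fun_prop
    · intro j
      simp only [hg.2.2.2.2 j]
    · intro j x _
      exact hQ E hER lam hlam x _ (hg.2.2.1 j x)
    · intro x
      exact hQ E hER lam hlam x _ (hDb x)
    · have h1 : 2 * K * w.1 + 1 ≤ N := by
        have : b ≤ b * l.length := Nat.le_mul_of_pos_right _ (by omega)
        omega
      have : ((2 * K * w.1 : ℕ) : ℝ) + 1 ≤ N := by exact_mod_cast h1
      exact mul_le_mul_of_nonneg_right this hT.le
    · intro j hj x hx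
      have hjb : j < b := by omega
      have hb0 : 0 < b := by omega
      have e : ((b * i : ℕ) : ℝ) * T + j * T + x = ((b * i + j : ℕ) : ℝ) * T + x := by push_cast; ring
      have eV : V (((b * i + j : ℕ) : ℝ) * T + x) = V x := by
        rw [add_comm]
        exact hper.nat_mul _ x
      have eD : D (((b * i + j : ℕ) : ℝ) * T + x) = w.2 j x := by
        rw [hDcell _ (by omega) x hx]
        have h1 : (b * i + j) / b = i := by
          rw [Nat.mul_add_div hb0, Nat.div_eq_of_lt hjb, add_zero]
        have h2 : (b * i + j) % b = j := by
          rw [Nat.mul_add_mod, Nat.mod_eq_of_lt hjb]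
        simp only [hc, h1, h2, hi, dif_pos, hwdef]
      simp only [e, eV, eD]
  calc _ ≤ volume (⋃ i, S i) := measure_mono hsub
    _ ≤ ∑ i, volume (S i) := measure_iUnion_fintype_le _ _
    _ ≤ ∑ _i : Fin l.length, ENNReal.ofReal (24 * m ^ 2 * δ) := by
        refine Finset.sum_le_sum fun i _ => ?_
        refine counting (L := N * T) (Q := Q) (by positivity) hδ hδ1 ?_ hn hm hsmall (fun E hE => hE.2) ?_
        · fun_prop
        · intro E hE x _
          exact hQ E hE.1 lam hlam _ _ (hDb _)
    _ = _ := by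
        rw [Finset.sum_const, Finset.card_univ, Fintype.card_fin, nsmul_eq_mul,
          ENNReal.ofReal_mul (p := (l.length : ℝ)) (by positivity), ENNReal.ofReal_natCast]



/-! ### Part M: assembly -/

lemma asym {A c T ρ : ℝ} {M : ℕ} (hA : 1 ≤ A) (hc : 0 < c) (hT : 0 < T) (hρ : 0 < ρ) (hρ1 : ρ < 1)
    (hM : 0 < M) : ∃ N₀ : ℕ, 0 < N₀ ∧ ∀ N : ℕ, N₀ ≤ N → c * ρ ^ ((N - 1) / M) ≤ 1 ∧
      A * (N:ℝ) ^ 4 * (c * ρ ^ ((N - 1) / M)) ≤ Real.exp (-Real.sqrt (N * T)) := by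
  set r := -Real.log ρ with hr
  have hr0 : 0 < r := by
    have := Real.log_neg hρ hρ1
    linarith
  have hMr : (0:ℝ) < M := by exact_mod_cast hM
  set b := r / M with hb
  have hb0 : 0 < b := by positivity
  set A2 := A * c * Real.exp (2 * r) * Real.exp (T / (2 * b)) with hA2
  have hA20 : 0 < A2 := by positivity
  have hlim : Tendsto (fun n : ℕ => (n:ℝ) ^ 4 * (Real.exp (-(b / 2))) ^ n) atTop (nhds 0) := by
    apply tendsto_pow_const_mul_const_pow_of_abs_lt_one
    rw [abs_of_pos (Real.exp_pos _), Real.exp_lt_one_iff]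
    linarith
  have hev := (hlim.eventually (ge_mem_nhds (show (0:ℝ) < A2⁻¹ by positivity)))
  obtain ⟨N₁, hN₁⟩ := eventually_atTop.1 hev
  refine ⟨N₁ + 1, by omega, fun N hN => ?_⟩
  have h1 := hN₁ N (by omega)
  have hN1 : 1 ≤ N := by omega
  have hN1r : (1:ℝ) ≤ N := by exact_mod_cast hN1
  set K := (N - 1) / M with hK
  have hKN : (N:ℝ) / M - 2 ≤ K := by
    have h2 : N - 1 < M * (K + 1) := by
      rw [hK]
      exact Nat.lt_mul_div_succ _ hM
    have h3 : N ≤ M * (K + 1) := by omega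
    have h4 : (N:ℝ) ≤ M * (K + 1) := by exact_mod_cast h3
    have : (N:ℝ) / M ≤ K + 1 := by
      rw [div_le_iff₀ hMr]; linarith
    linarith
  have hρK : ρ ^ K ≤ Real.exp (2 * r) * Real.exp (-(b * N)) := by
    rw [← Real.exp_add, ← Real.exp_log hρ, ← Real.exp_nat_mul, Real.exp_le_exp]
    have : Real.log ρ = -r := by rw [hr]; ring
    rw [this]
    have e : b * N = r * (N / M) := by rw [hb]; ring
    rw [e]
    nlinarith
  have hsq : Real.sqrt (N * T) ≤ b / 2 * N + T / (2 * b) := by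
    apply Real.sqrt_le_iff.2
    refine ⟨by positivity, ?_⟩
    have e : (N:ℝ) * T = 4 * (b / 2 * N) * (T / (2 * b)) := by field_simp; ring
    nlinarith [sq_nonneg (b / 2 * N - T / (2 * b))]
  have hmain : A * (N:ℝ) ^ 4 * (c * ρ ^ K) ≤ Real.exp (-Real.sqrt (N * T)) := by
    have e1 : Real.exp (-(b * N)) ≤ Real.exp (-(b / 2)) ^ N * Real.exp (T / (2 * b)) * Real.exp (-Real.sqrt (N * T)) := by
      rw [← Real.exp_nat_mul, ← Real.exp_add, ← Real.exp_add, Real.exp_le_exp]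
      linarith
    calc A * (N:ℝ) ^ 4 * (c * ρ ^ K) ≤ A * (N:ℝ) ^ 4 * (c * (Real.exp (2 * r) * (Real.exp (-(b / 2)) ^ N * Real.exp (T / (2 * b)) * Real.exp (-Real.sqrt (N * T))))) := by
          gcongr
          exact hρK.trans (by gcongr)
      _ = A2 * ((N:ℝ) ^ 4 * (Real.exp (-(b / 2))) ^ N) * Real.exp (-Real.sqrt (N * T)) := by rw [hA2]; ring
      _ ≤ A2 * A2⁻¹ * Real.exp (-Real.sqrt (N * T)) := by gcongr
      _ = _ := by rw [mul_inv_cancel₀ hA20.ne', one_mul]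
  refine ⟨?_, hmain⟩
  have h5 : (1:ℝ) ≤ A * (N:ℝ) ^ 4 := by
    have : (1:ℝ) ≤ (N:ℝ) ^ 4 := one_le_pow₀ hN1r
    nlinarith
  calc c * ρ ^ K ≤ A * (N:ℝ) ^ 4 * (c * ρ ^ K) := le_mul_of_one_le_left (by positivity) h5
    _ ≤ _ := hmain
    _ ≤ 1 := Real.exp_le_one_iff.2 (neg_nonpos.2 (Real.sqrt_nonneg _))

theorem exists_periodic_approx_small_spectrum (V : ℝ → ℝ) (T : ℝ)
    (hV : Continuous V) (hT : 0 < T) (hper : Function.Periodic V T)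
    (ε Λ R : ℝ) (hε : 0 < ε) (hΛ : 1 < Λ) (hR : 1 < R) :
    ∃ N₀ : ℕ, 0 < N₀ ∧ ∀ N : ℕ, N₀ ≤ N →
      ∃ Vt : ℝ → ℝ, Continuous Vt ∧ Function.Periodic Vt (N * T) ∧
        (⨆ x : ℝ, |V x - Vt x|) < ε ∧
        ∀ lam ∈ Set.Icc Λ⁻¹ Λ,
          volume (schrodingerSpectrum (fun x => lam * Vt x) ∩ Set.Icc (-R) R)
            ≤ ENNReal.ofReal (Real.exp (-Real.sqrt (N * T))) := by
  have hΛ0 : 0 < Λ := by linarith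
  obtain ⟨l, hl, τ, hτ, htr⟩ := global_walls hT hV (half_pos hε)
    (s := Icc (-R) R ×ˢ Icc Λ⁻¹ Λ) (isCompact_Icc.prod isCompact_Icc)
    (fun p hp => lt_of_lt_of_le (by positivity) hp.2.1)
  obtain ⟨C, hC, hCs⟩ := sobolev hT
  -- bound for the potential
  obtain ⟨Q₀, hQ₀⟩ := (isCompact_Icc (a := (0:ℝ)) (b := T)).exists_bound_of_continuousOn hV.continuousOn
  have hVb : ∀ x, |V x| ≤ Q₀ := by
    intro x
    obtain ⟨y, hy, hxy⟩ := hper.exists_mem_Ico₀ hT x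
    rw [hxy]
    exact hQ₀ y ⟨hy.1, hy.2.le⟩
  have hQ₀0 : 0 ≤ Q₀ := (abs_nonneg _).trans (hVb 0)
  set Q := Λ * (Q₀ + ε / 2) + R with hQdef
  have hQ1 : 1 ≤ Q := by
    have : 0 ≤ Λ * (Q₀ + ε / 2) := by positivity
    linarith
  have hQ : ∀ E ∈ Icc (-R) R, ∀ lam ∈ Icc Λ⁻¹ Λ, ∀ x d : ℝ, |d| ≤ ε / 2 → |lam * (V x + d) - E| ≤ Q := by
    intro E hE lam hlam x d hd
    have hl0 : 0 < lam := lt_of_lt_of_le (by positivity) hlam.1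
    calc |lam * (V x + d) - E| ≤ |lam * (V x + d)| + |E| := abs_sub _ _
      _ = lam * |V x + d| + |E| := by rw [abs_mul, abs_of_pos hl0]
      _ ≤ Λ * (Q₀ + ε / 2) + R := by
          gcongr
          · exact hlam.2
          · exact (abs_add_le _ _).trans (add_le_add (hVb x) hd)
          · exact abs_le.2 hE
  -- size of the walls
  have hlpos : 0 < l.length := by
    obtain ⟨w, hw, _⟩ := htr (0, 1) ⟨⟨by simp; linarith, by simp; linarith⟩,
      ⟨by simpa using inv_le_one_of_one_le₀ hΛ.le, hΛ.le⟩⟩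
    exact List.length_pos_of_mem hw
  set ns := (l.map Prod.fst).sum + 1 with hnsdef
  have hns : ∀ w ∈ l, w.1 ≤ ns := by
    intro w hw
    have : w.1 ≤ (l.map Prod.fst).sum := List.le_sum_of_mem (List.mem_map_of_mem hw)
    omega
  set M := 2 * ns * l.length with hM
  have hM0 : 0 < M := by positivity
  obtain ⟨g, hg⟩ := exists_nat_gt (12 * T ^ 4 * (Q ^ 2 + 1) + 1)
  have hg1 : (1:ℝ) < g := lt_of_le_of_lt (by linarith [show 0 ≤ 12 * T ^ 4 * (Q ^ 2 + 1) by positivity]) hg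
  have hg0 : 0 < g := by
    have : (0:ℝ) < g := by linarith
    exact_mod_cast this
  set c := Real.sqrt (8 * C * (1 + 2 * Q ^ 2)) + 1 with hc
  have hc0 : 0 < c := by positivity
  have hc2 : 8 * C * (1 + 2 * Q ^ 2) < c ^ 2 := by
    have h1 : Real.sqrt (8 * C * (1 + 2 * Q ^ 2)) ^ 2 = 8 * C * (1 + 2 * Q ^ 2) := Real.sq_sqrt (by positivity)
    have h2 := Real.sqrt_nonneg (8 * C * (1 + 2 * Q ^ 2))
    nlinarith
  set ρ := 2 / (2 + τ) with hρ
  have hρ0 : 0 < ρ := by positivity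
  have hρ1 : ρ < 1 := by rw [hρ, div_lt_one (by positivity)]; linarith
  set A : ℝ := l.length * (24 * (3 * g) ^ 2) with hA
  have hlr : (1:ℝ) ≤ l.length := by exact_mod_cast hlpos
  have hA1 : 1 ≤ A := by nlinarith
  obtain ⟨N₀, hN₀, has⟩ := asym hA1 hc0 hT hρ0 hρ1 hM0
  refine ⟨N₀, hN₀, fun N hN => ?_⟩
  obtain ⟨hδ1, hfin⟩ := has N hN
  set K := (N - 1) / M with hK
  have hN1 : 1 ≤ N := by omega
  have hN1r : (1:ℝ) ≤ N := by exact_mod_cast hN1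
  have hKN : 2 * K * ns * l.length + 1 ≤ N := by
    have : K * M ≤ N - 1 := Nat.div_mul_le_self _ _
    have e : 2 * K * ns * l.length = K * M := by rw [hM]; ring
    omega
  have hδ0 : 0 < c * ρ ^ K := by positivity
  have hn0 : 0 < g * N ^ 2 := by positivity
  have hnr : (1:ℝ) ≤ g * (N:ℝ) ^ 2 := by exact_mod_cast hn0
  obtain ⟨Vt, h1, h2, h3, h4⟩ := measure_bound hT hV hper hC hCs (half_pos hε).le hl hτ htr hQ1 hQ
    hns hKN hδ0 hδ1 (by
      rw [mul_pow]
      have : 0 < (ρ ^ K) ^ 2 := by positivity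
      nlinarith) (n := g * N ^ 2) hn0 rfl (by
      push_cast
      have hN0 : (N:ℝ) ≠ 0 := by positivity
      have e : (N * T / (g * (N:ℝ) ^ 2)) ^ 4 * (3 * (g * (N:ℝ) ^ 2)) = 3 * T ^ 4 / (g ^ 3 * (N:ℝ) ^ 2) := by
        field_simp
      have e2 : 12 * T ^ 4 * (Q ^ 2 + 1) < g ^ 3 * (N:ℝ) ^ 2 := by
        have a1 : (1:ℝ) ≤ (N:ℝ) ^ 2 := one_le_pow₀ hN1r
        have a2 : (g:ℝ) ≤ g ^ 3 := le_self_pow₀ hg1.le (by norm_num)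
        have a3 : (g:ℝ) ^ 3 ≤ g ^ 3 * (N:ℝ) ^ 2 := le_mul_of_one_le_right (by positivity) a1
        linarith
      calc 4 * (N * T / (g * (N:ℝ) ^ 2)) ^ 4 * (2 * (g * (N:ℝ) ^ 2) + 1) * (Q ^ 2 + 1)
          ≤ 4 * (N * T / (g * (N:ℝ) ^ 2)) ^ 4 * (3 * (g * (N:ℝ) ^ 2)) * (Q ^ 2 + 1) := by
            gcongr; linarith
        _ = 4 * ((N * T / (g * (N:ℝ) ^ 2)) ^ 4 * (3 * (g * (N:ℝ) ^ 2))) * (Q ^ 2 + 1) := by ring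
        _ = (12 * T ^ 4 * (Q ^ 2 + 1)) / (g ^ 3 * (N:ℝ) ^ 2) := by rw [e]; ring
        _ < 1 := by rw [div_lt_one (by positivity)]; exact e2)
  refine ⟨Vt, h1, h2, lt_of_le_of_lt (ciSup_le h3) (half_lt_self hε), fun lam hlam => ?_⟩
  refine (h4 lam hlam).trans (ENNReal.ofReal_le_ofReal (le_trans ?_ hfin))
  push_cast
  calc (l.length:ℝ) * (24 * (2 * (g * (N:ℝ) ^ 2) + 1) ^ 2 * (c * ρ ^ K))
      ≤ (l.length:ℝ) * (24 * (3 * (g * (N:ℝ) ^ 2)) ^ 2 * (c * ρ ^ K)) := by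
        gcongr; linarith
    _ = _ := by rw [hA]; ring
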